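/- arXiv:1504.08223 — 3 statements merged into one kernel-verified Lean document; each statement's English description precedes it below -/
import Mathlib

section
/- Let (μ_i)_i be a bounded sequence in the dual space C([0,1], ℝ)* (equivalently, in the space M[0,1] of finite signed Borel measures on [0,1] with the total variation norm). Then there exists a sequence (t_i)_i of points of [0,1] such that, setting ν_i = μ_i + δ_{t_i} (where δ_t ∈ C([0,1], ℝ)* is the evaluation functional f ↦ f(t)), the following hold: (i) the sequence (ν_i)_i is equivalent to the unit vector basis of ℓ1(ℕ), i.e., there exist constants a, b > 0 such that a ∑_i |λ_i| ≤ ‖∑_i λ_i ν_i‖ ≤ b ∑_i |λ_i| for all finitely supported scalars (λ_i); (ii) the closed linear span Y of (ν_i)_i is complemented in C([0,1], ℝ)*, i.e., there is a bounded linear projection from C([0,1], ℝ)* onto Y. -/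
open Filter Topology

noncomputable section

/-- The Banach space `C([0,1], ℝ)`. -/
abbrev CI : Type := C(↥(Set.Icc (0 : ℝ) 1), ℝ)

/-- The Dirac functional `δ_t : f ↦ f t` on `C([0,1], ℝ)`. -/
def dirac (t : ↥(Set.Icc (0 : ℝ) 1)) : CI →L[ℝ] ℝ :=
  ContinuousMap.evalCLM ℝ t

/-- The tent function of height one and slope `n` with peak at `t`. -/
def tent {X : Type*} [MetricSpace X] (t : X) (n : ℕ) : C(X, ℝ) where
  toFun x := max 0 (1 - n * dist x t)
  continuous_toFun := by fun_prop

section Tent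

variable {X : Type*} [MetricSpace X]

lemma tent_apply (t : X) (n : ℕ) (x : X) : tent t n x = max 0 (1 - n * dist x t) := rfl

lemma tent_nonneg (t : X) (n : ℕ) (x : X) : 0 ≤ tent t n x := le_max_left _ _

lemma tent_le_one (t : X) (n : ℕ) (x : X) : tent t n x ≤ 1 :=
  max_le zero_le_one (sub_le_self _ (by positivity))

lemma tent_self (t : X) (n : ℕ) : tent t n t = 1 := by simp [tent_apply]

lemma tent_eq_zero {t x : X} {n : ℕ} (h : 1 ≤ n * dist x t) : tent t n x = 0 :=
  max_eq_left (by linarith)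

lemma eventually_le_nat_mul {d : ℝ} (hd : 0 < d) (c : ℝ) : ∀ᶠ n : ℕ in atTop, c ≤ n * d :=
  (tendsto_natCast_atTop_atTop.atTop_mul_const hd).eventually_ge_atTop c

/-- Tent functions at distinct points have eventually disjoint supports. -/
lemma eventually_tent_disjoint (s : Finset X) :
    ∀ᶠ n : ℕ in atTop, ∀ t ∈ s, ∀ u ∈ s, t ≠ u → ∀ x, tent t n x = 0 ∨ tent u n x = 0 := by
  refine (Filter.eventually_all_finset s).2 fun t _ ↦ (Filter.eventually_all_finset s).2
    fun u _ ↦ ?_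
  by_cases htu : t = u
  · simp [htu]
  filter_upwards [eventually_le_nat_mul (dist_pos.2 htu) 2] with n hn _ x
  by_contra! h
  have h₁ : n * dist x t < 1 := lt_of_not_ge fun h' ↦ h.1 (tent_eq_zero h')
  have h₂ : n * dist x u < 1 := lt_of_not_ge fun h' ↦ h.2 (tent_eq_zero h')
  have h₃ : n * dist t u ≤ n * (dist x t + dist x u) := by
    gcongr
    exact dist_triangle_left t u x
  linarith

variable [CompactSpace X]

lemma norm_tent_le_one (t : X) (n : ℕ) : ‖tent t n‖ ≤ 1 :=
  (ContinuousMap.norm_le _ zero_le_one).2 fun x ↦ by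
    rw [Real.norm_of_nonneg (tent_nonneg t n x)]
    exact tent_le_one t n x

lemma eventually_sum_abs_apply_tent_le (φ : C(X, ℝ) →L[ℝ] ℝ) (s : Finset X) :
    ∀ᶠ n : ℕ in atTop, ∑ t ∈ s, |φ (tent t n)| ≤ ‖φ‖ := by
  filter_upwards [eventually_tent_disjoint s] with n hn
  let ε : X → ℝ := fun t ↦ SignType.sign (φ (tent t n))
  have hε (t : X) : |ε t| ≤ 1 := by
    rcases lt_trichotomy (φ (tent t n)) 0 with h | h | h <;> simp [ε, h]
  have hnorm : ‖∑ t ∈ s, ε t • tent t n‖ ≤ 1 := by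
    refine (ContinuousMap.norm_le _ zero_le_one).2 fun x ↦ ?_
    rw [ContinuousMap.coe_sum, Finset.sum_apply]
    by_cases h : ∃ t ∈ s, tent t n x ≠ 0
    · obtain ⟨t, ht, htx⟩ := h
      rw [Finset.sum_eq_single_of_mem t ht fun u hu hut ↦ by
        simp [(hn u hu t ht hut x).resolve_right htx]]
      rw [ContinuousMap.smul_apply, norm_smul, Real.norm_of_nonneg (tent_nonneg t n x)]
      exact mul_le_one₀ (hε t) (tent_nonneg t n x) (tent_le_one t n x)
    · push Not at h
      rw [Finset.sum_eq_zero fun t ht ↦ by simp [h t ht]]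
      simp
  calc ∑ t ∈ s, |φ (tent t n)| = φ (∑ t ∈ s, ε t • tent t n) := by
        simp [ε, map_sum, sign_mul_self]
    _ ≤ ‖φ (∑ t ∈ s, ε t • tent t n)‖ := Real.le_norm_self _
    _ ≤ ‖φ‖ * 1 := φ.le_opNorm_of_le hnorm
    _ = ‖φ‖ := mul_one _

lemma exists_tendsto_apply_tent (φ : C(X, ℝ) →L[ℝ] ℝ) (t : X) :
    ∃ c, Tendsto (fun n : ℕ ↦ φ (tent t n)) (hyperfilter ℕ : Filter ℕ) (𝓝 c) := by
  obtain ⟨c, -, hc⟩ := (isCompact_closedBall (0 : ℝ) ‖φ‖).ultrafilter_le_nhds'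
    ((hyperfilter ℕ).map fun n : ℕ ↦ φ (tent t n))
    (Filter.eventually_map.2 (Filter.Eventually.of_forall fun n ↦ by
      simpa using φ.le_opNorm_of_le (norm_tent_le_one t n)))
  exact ⟨c, hc⟩

/-- The mass which a functional on `C(X, ℝ)`, viewed as a signed measure, gives to `{t}`. -/
def atomMass (t : X) : (C(X, ℝ) →L[ℝ] ℝ) →ₗ[ℝ] ℝ where
  toFun φ := (exists_tendsto_apply_tent φ t).choose
  map_add' φ ψ := tendsto_nhds_unique (exists_tendsto_apply_tent (φ + ψ) t).choose_spec
    ((exists_tendsto_apply_tent φ t).choose_spec.add (exists_tendsto_apply_tent ψ t).choose_spec)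
  map_smul' c φ := tendsto_nhds_unique (exists_tendsto_apply_tent (c • φ) t).choose_spec
    ((exists_tendsto_apply_tent φ t).choose_spec.const_mul c)

lemma tendsto_atomMass (φ : C(X, ℝ) →L[ℝ] ℝ) (t : X) :
    Tendsto (fun n ↦ φ (tent t n)) (hyperfilter ℕ : Filter ℕ) (𝓝 (atomMass t φ)) :=
  (exists_tendsto_apply_tent φ t).choose_spec

lemma sum_abs_atomMass_le (φ : C(X, ℝ) →L[ℝ] ℝ) (s : Finset X) :
    ∑ t ∈ s, |atomMass t φ| ≤ ‖φ‖ :=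
  le_of_tendsto (tendsto_finsetSum s fun t _ ↦ (tendsto_atomMass φ t).abs)
    ((eventually_sum_abs_apply_tent_le φ s).filter_mono Nat.hyperfilter_le_atTop)

lemma countable_support_atomMass (φ : C(X, ℝ) →L[ℝ] ℝ) :
    {t : X | atomMass t φ ≠ 0}.Countable := by
  have := (summable_of_sum_le (fun t ↦ abs_nonneg (atomMass t φ))
    (sum_abs_atomMass_le φ)).countable_support
  simpa [Function.support] using this

lemma atomMass_evalCLM_self (t : X) : atomMass t (ContinuousMap.evalCLM ℝ t) = 1 :=
  tendsto_nhds_unique (tendsto_atomMass _ t) (by simp [tent_self])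

lemma atomMass_evalCLM_of_ne {s t : X} (h : s ≠ t) :
    atomMass t (ContinuousMap.evalCLM ℝ s) = 0 := by
  refine tendsto_nhds_unique (tendsto_atomMass _ t) (tendsto_const_nhds.congr' ?_)
  refine Filter.Eventually.filter_mono Nat.hyperfilter_le_atTop ?_
  filter_upwards [eventually_le_nat_mul (dist_pos.2 h) 1] with n hn
  exact (tent_eq_zero hn).symm

end Tent

section Biorthogonal

variable {E : Type*} [NormedAddCommGroup E] [NormedSpace ℝ E] {L : ℕ → E →ₗ[ℝ] ℝ} {ν : ℕ → E}
  {B : ℝ}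

lemma norm_sum_smul_le (hB : ∀ i, ‖ν i‖ ≤ B) (A : Finset ℕ) (c : ℕ → ℝ) :
    ‖∑ i ∈ A, c i • ν i‖ ≤ B * ∑ i ∈ A, |c i| := by
  rw [Finset.mul_sum]
  refine norm_sum_le_of_le A fun i _ ↦ ?_
  rw [norm_smul, mul_comm, Real.norm_eq_abs]
  gcongr
  exact hB i

lemma sum_abs_le_norm_sum_smul (hL : ∀ x (A : Finset ℕ), ∑ i ∈ A, |L i x| ≤ ‖x‖)
    (hLν : ∀ i j, L i (ν j) = if i = j then 1 else 0) (A : Finset ℕ) (c : ℕ → ℝ) :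
    ∑ i ∈ A, |c i| ≤ ‖∑ i ∈ A, c i • ν i‖ := by
  refine le_of_eq_of_le (Finset.sum_congr rfl fun i hi ↦ ?_) (hL (∑ i ∈ A, c i • ν i) A)
  simp [map_sum, hLν, hi]

/-- A bounded sequence with an absolutely summing biorthogonal sequence of functionals spans a
complemented closed subspace. -/
lemma exists_projection_closure_span [CompleteSpace E]
    (hL : ∀ x (A : Finset ℕ), ∑ i ∈ A, |L i x| ≤ ‖x‖)
    (hLν : ∀ i j, L i (ν j) = if i = j then 1 else 0) (hB : ∀ i, ‖ν i‖ ≤ B) :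
    ∃ P : E →L[ℝ] E, (∀ x, P x ∈ (Submodule.span ℝ (Set.range ν)).topologicalClosure) ∧
      ∀ x ∈ (Submodule.span ℝ (Set.range ν)).topologicalClosure, P x = x := by
  have hB₀ : 0 ≤ B := (norm_nonneg _).trans (hB 0)
  have habs (x : E) : Summable fun i ↦ |L i x| :=
    summable_of_sum_le (fun _ ↦ abs_nonneg _) (hL x)
  have hle (x : E) (i : ℕ) : ‖L i x • ν i‖ ≤ |L i x| * B := by
    rw [norm_smul, Real.norm_eq_abs]
    gcongr
    exact hB i
  have hsum (x : E) : Summable fun i ↦ L i x • ν i :=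
    Summable.of_norm_bounded ((habs x).mul_right B) (hle x)
  let P₀ : E →ₗ[ℝ] E :=
    { toFun x := ∑' i, L i x • ν i
      map_add' x y := by
        simp only [map_add, add_smul]
        exact (hsum x).tsum_add (hsum y)
      map_smul' c x := by
        simp only [map_smul, smul_assoc, RingHom.id_apply]
        exact (hsum x).tsum_const_smul c }
  let P : E →L[ℝ] E := P₀.mkContinuous B fun x ↦ by
    calc ‖∑' i, L i x • ν i‖ ≤ ∑' i, |L i x| * B :=
          tsum_of_norm_bounded ((habs x).mul_right B).hasSum (hle x)
      _ = B * ∑' i, |L i x| := by rw [tsum_mul_right, mul_comm]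
      _ ≤ B * ‖x‖ := by
          gcongr
          exact Real.tsum_le_of_sum_le (fun _ ↦ abs_nonneg _) (hL x)
  have hP (x : E) : P x = ∑' i, L i x • ν i := rfl
  refine ⟨P, fun x ↦ ?_, fun x hx ↦ ?_⟩
  · refine (Submodule.isClosed_topologicalClosure _).mem_of_tendsto (hsum x).hasSum
      (Filter.Eventually.of_forall fun A ↦ ?_)
    exact Submodule.sum_mem _ fun i _ ↦ Submodule.smul_mem _ _
      (Submodule.le_topologicalClosure _ (Submodule.subset_span ⟨i, rfl⟩))
  · have hspan : Submodule.span ℝ (Set.range ν) ≤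
        LinearMap.eqLocus (P : E →ₗ[ℝ] E) LinearMap.id := by
      rw [Submodule.span_le]
      rintro _ ⟨j, rfl⟩
      change P (ν j) = ν j
      rw [hP, tsum_eq_single j fun i hi ↦ by simp [hLν, hi]]
      simp [hLν]
    exact Submodule.topologicalClosure_minimal _ hspan
      (isClosed_eq P.continuous continuous_id) hx

end Biorthogonal

/-- An uncountable type contains an injective sequence avoiding a given countable set. -/
lemma exists_injective_notMem_of_countable {X : Type*} [Uncountable X] {S : Set X}
    (hS : S.Countable) : ∃ t : ℕ → X, Function.Injective t ∧ ∀ i, t i ∉ S := by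
  have : Infinite ↥Sᶜ := by
    refine Set.infinite_coe_iff.2 fun h ↦ Set.not_countable_univ (α := X) ?_
    rw [← Set.union_compl_self S]
    exact hS.union h.countable
  exact ⟨fun i ↦ Infinite.natEmbedding ↥Sᶜ i,
    Subtype.val_injective.comp (Infinite.natEmbedding ↥Sᶜ).injective,
    fun i ↦ (Infinite.natEmbedding ↥Sᶜ i).2⟩

/-- Every bounded sequence of functionals on `C(X, ℝ)` becomes, after adding suitable Dirac
functionals, a sequence equivalent to the unit vector basis of `ℓ1` with complemented closed
span. -/
theorem exists_add_evalCLM_complemented {X : Type*} [MetricSpace X] [CompactSpace X]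
    [Uncountable X] (μ : ℕ → (C(X, ℝ) →L[ℝ] ℝ)) (hbdd : ∃ B : ℝ, ∀ i, ‖μ i‖ ≤ B) :
    ∃ t : ℕ → X, ∀ ν : ℕ → (C(X, ℝ) →L[ℝ] ℝ),
      (ν = fun i ↦ μ i + ContinuousMap.evalCLM ℝ (t i)) →
      (∃ a : ℝ, 0 < a ∧ ∃ b : ℝ, 0 < b ∧ ∀ (A : Finset ℕ) (c : ℕ → ℝ),
        a * ∑ i ∈ A, |c i| ≤ ‖∑ i ∈ A, c i • ν i‖ ∧
        ‖∑ i ∈ A, c i • ν i‖ ≤ b * ∑ i ∈ A, |c i|) ∧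
      (∃ P : (C(X, ℝ) →L[ℝ] ℝ) →L[ℝ] (C(X, ℝ) →L[ℝ] ℝ),
        (∀ f, P f ∈ (Submodule.span ℝ (Set.range ν)).topologicalClosure) ∧
        (∀ f ∈ (Submodule.span ℝ (Set.range ν)).topologicalClosure, P f = f)) := by
  obtain ⟨B, hB⟩ := hbdd
  obtain ⟨t, ht, hμt⟩ := exists_injective_notMem_of_countable
    (Set.countable_iUnion fun j ↦ countable_support_atomMass (μ j))
  have hμ (i j : ℕ) : atomMass (t i) (μ j) = 0 := by
    by_contra h
    exact hμt i (Set.mem_iUnion.2 ⟨j, h⟩)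
  refine ⟨t, fun ν hν ↦ ?_⟩
  have hL (φ : C(X, ℝ) →L[ℝ] ℝ) (A : Finset ℕ) : ∑ i ∈ A, |atomMass (t i) φ| ≤ ‖φ‖ := by
    simpa using sum_abs_atomMass_le φ (A.map ⟨t, ht⟩)
  have hLν (i j : ℕ) : atomMass (t i) (ν j) = if i = j then 1 else 0 := by
    rw [hν, map_add, hμ, zero_add]
    split_ifs with h
    · rw [h, atomMass_evalCLM_self]
    · exact atomMass_evalCLM_of_ne fun h' ↦ h (ht h').symm
  have hdirac (s : X) : ‖(ContinuousMap.evalCLM ℝ s : C(X, ℝ) →L[ℝ] ℝ)‖ ≤ 1 :=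
    ContinuousLinearMap.opNorm_le_bound _ zero_le_one fun f ↦ by
      simpa using f.norm_coe_le_norm s
  have hνB (i : ℕ) : ‖ν i‖ ≤ B + 1 := by
    rw [hν]
    exact (norm_add_le (μ i) (ContinuousMap.evalCLM ℝ (t i))).trans (add_le_add (hB i) (hdirac _))
  have hB₀ : 0 ≤ B := (norm_nonneg (μ 0)).trans (hB 0)
  have hupper := norm_sum_smul_le (E := C(X, ℝ) →L[ℝ] ℝ) hνB
  have hlower := sum_abs_le_norm_sum_smul (E := C(X, ℝ) →L[ℝ] ℝ) (L := fun i ↦ atomMass (t i))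
    hL hLν
  have hproj := exists_projection_closure_span (E := C(X, ℝ) →L[ℝ] ℝ) (L := fun i ↦ atomMass (t i))
    hL hLν hνB
  refine ⟨⟨1, one_pos, B + 1, by positivity, fun A c ↦ ⟨?_, hupper A c⟩⟩, hproj⟩
  simpa only [one_mul] using hlower A c

/-- For every bounded sequence `(μ_i)_i` in `C([0,1],ℝ)^* = M[0,1]` there is a
sequence `(t_i)_i` in `[0,1]` such that, with `ν_i = μ_i + δ_{t_i}`, the sequence `(ν_i)_i` is
equivalent to the unit vector basis of `ℓ1(ℕ)` and its closed linear span is complemented in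
`C([0,1],ℝ)^*`. -/
theorem statement10 (μ : ℕ → (CI →L[ℝ] ℝ)) (hbdd : ∃ B : ℝ, ∀ i, ‖μ i‖ ≤ B) :
    ∃ t : ℕ → ↥(Set.Icc (0 : ℝ) 1), ∀ ν : ℕ → (CI →L[ℝ] ℝ),
      (ν = fun i => μ i + dirac (t i)) →
      (∃ a : ℝ, 0 < a ∧ ∃ b : ℝ, 0 < b ∧ ∀ (A : Finset ℕ) (lam : ℕ → ℝ),
        a * ∑ i ∈ A, |lam i| ≤ ‖∑ i ∈ A, lam i • ν i‖ ∧
        ‖∑ i ∈ A, lam i • ν i‖ ≤ b * ∑ i ∈ A, |lam i|) ∧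
      (∃ P : (CI →L[ℝ] ℝ) →L[ℝ] (CI →L[ℝ] ℝ),
        (∀ f, P f ∈ (Submodule.span ℝ (Set.range ν)).topologicalClosure) ∧
        (∀ f ∈ (Submodule.span ℝ (Set.range ν)).topologicalClosure, P f = f)) := by
  have : Uncountable ↥(Set.Icc (0 : ℝ) 1) := by
    rw [← Cardinal.aleph0_lt_mk_iff, Cardinal.mk_Icc_real zero_lt_one]
    exact Cardinal.aleph0_lt_continuum
  exact exists_add_evalCLM_complemented μ hbdd
end
end

section
/- Let X be an infinite-dimensional separable L∞-space. Then there exists a sequence (x_i*)_i in X* such that: (i) (x_i*)_i is equivalent to the unit vector basis of ℓ1(ℕ), i.e., there exist a, b > 0 with a ∑_i |λ_i| ≤ ‖∑_i λ_i x_i*‖ ≤ b ∑_i |λ_i| for all finitely supported scalars (λ_i); (ii) there exists θ > 0 such that θ‖x‖ ≤ sup_i |x_i*(x)| for all x ∈ X; (iii) the closed linear span Y of (x_i*)_i is complemented in X*, i.e., there is a bounded linear projection from X* onto Y. -/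
open Filter Topology

noncomputable section

/-- A Banach space `X` is an `L_{∞,C}`-space if every finite dimensional subspace is contained
in a finite dimensional subspace `G` which is `C`-isomorphic to `ℓ∞^{dim G}`. -/
def IsLinftyCSpace (X : Type*) [NormedAddCommGroup X] [NormedSpace ℝ X] (C : ℝ) : Prop :=
  ∀ F : Submodule ℝ X, FiniteDimensional ℝ ↥F →
    ∃ G : Submodule ℝ X, F ≤ G ∧ FiniteDimensional ℝ ↥G ∧
      ∃ T : ↥G ≃L[ℝ] (Fin (Module.finrank ℝ ↥G) → ℝ),
        ‖(T : ↥G →L[ℝ] (Fin (Module.finrank ℝ ↥G) → ℝ))‖ *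
          ‖(T.symm : (Fin (Module.finrank ℝ ↥G) → ℝ) →L[ℝ] ↥G)‖ ≤ C

/-- A Banach space is an `L_∞`-space if it is an `L_{∞,C}`-space for some `C ≥ 1`. -/
def IsLinftySpace (X : Type*) [NormedAddCommGroup X] [NormedSpace ℝ X] : Prop :=
  ∃ C : ℝ, 1 ≤ C ∧ IsLinftyCSpace X C

theorem lp_one_norm_apply_le {Y : Type*} [NormedAddCommGroup Y] [NormedSpace ℝ Y]
    (A : lp (fun _ : ℕ => ℝ) 1 →L[ℝ] Y) {c : ℝ} (hc : 0 ≤ c)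
    (hA : ∀ k, ‖A (lp.single 1 k (1 : ℝ))‖ ≤ c) : ‖A‖ ≤ c := by
  refine A.opNorm_le_bound hc fun u => ?_
  have h1 : HasSum (fun k => A (lp.single 1 k (u k))) (A u) :=
    A.hasSum (lp.hasSum_single (by simp) u)
  have h2 : HasSum (fun k => ‖u k‖) ‖u‖ := by
    have := lp.hasSum_norm (p := 1) (by simp) u
    simpa using this
  have h3 : HasSum (fun k => c * ‖u k‖) (c * ‖u‖) := h2.mul_left c
  refine h1.norm_le_of_bounded h3 fun k => ?_
  have h4 : lp.single (E := fun _ : ℕ => ℝ) 1 k (u k) = u k • lp.single 1 k (1 : ℝ) := by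
    rw [← lp.single_smul]; simp
  rw [h4, map_smul, norm_smul, mul_comm]
  gcongr
  exact hA k

theorem exists_projection_of_almost_biorthogonal {E : Type*} [NormedAddCommGroup E]
    [NormedSpace ℝ E] [CompleteSpace E] (x : ℕ → E) (ψ : ℕ → E →L[ℝ] ℝ) {b K : ℝ}
    (hb : ∀ k, ‖x k‖ ≤ b) (hK : ∀ (f : E) (S : Finset ℕ), ∑ j ∈ S, |ψ j f| ≤ K * ‖f‖)
    (hψ : ∀ (k : ℕ) (S : Finset ℕ), ∑ j ∈ S, |ψ j (x k) - if j = k then 1 else 0| ≤ 1 / 2) :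
    ∃ P : E →L[ℝ] E,
      (∀ f, P f ∈ (Submodule.span ℝ (Set.range x)).topologicalClosure) ∧
      (∀ f ∈ (Submodule.span ℝ (Set.range x)).topologicalClosure, P f = f) := by
  have hK0 : ∀ f, 0 ≤ K * ‖f‖ := fun f => by simpa using hK f ∅
  have hmem : ∀ f, Memℓp (fun j => ψ j f) 1 := fun f =>
    memℓp_gen' (C := K * ‖f‖) fun S => by simpa using hK f S
  let R₀ : E →ₗ[ℝ] lp (fun _ : ℕ => ℝ) 1 :=
    { toFun := fun f => ⟨fun j => ψ j f, hmem f⟩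
      map_add' := fun f g => by ext j; exact map_add (ψ j) f g
      map_smul' := fun r f => by ext j; exact map_smul (ψ j) r f }
  let R : E →L[ℝ] lp (fun _ : ℕ => ℝ) 1 := R₀.mkContinuous K fun f =>
    lp.norm_le_of_forall_sum_le (by simp) (hK0 f) fun S => by simpa [R₀] using hK f S
  have hR : ∀ f j, R f j = ψ j f := fun f j => rfl
  have hsumn : ∀ u : lp (fun _ : ℕ => ℝ) 1, HasSum (fun k => ‖u k‖) ‖u‖ := fun u => by
    simpa using lp.hasSum_norm (p := 1) (by simp) u
  have hbd : ∀ (u : lp (fun _ : ℕ => ℝ) 1) k, ‖u k • x k‖ ≤ b * ‖u k‖ := fun u k => by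
    rw [norm_smul, mul_comm]; gcongr; exact hb k
  have hsum : ∀ u : lp (fun _ : ℕ => ℝ) 1, Summable (fun k => u k • x k) := fun u =>
    Summable.of_norm_bounded ((hsumn u).mul_left b).summable (hbd u)
  let T₀ : lp (fun _ : ℕ => ℝ) 1 →ₗ[ℝ] E :=
    { toFun := fun u => ∑' k, u k • x k
      map_add' := fun u v => by
        rw [← (hsum u).tsum_add (hsum v)]; simp [add_smul]
      map_smul' := fun r u => by
        rw [RingHom.id_apply, ← (hsum u).tsum_const_smul]; simp [smul_smul] }
  let T : lp (fun _ : ℕ => ℝ) 1 →L[ℝ] E := T₀.mkContinuous b fun u =>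
    (hsum u).hasSum.norm_le_of_bounded ((hsumn u).mul_left b) (hbd u)
  have hT : ∀ u, T u = ∑' k, u k • x k := fun u => rfl
  have hTe : ∀ k, T (lp.single 1 k (1 : ℝ)) = x k := fun k => by
    rw [hT, tsum_eq_single k]
    · simp
    · intro j hj; simp [hj]
  have hD : ‖1 - R ∘L T‖ ≤ 1 / 2 := by
    refine lp_one_norm_apply_le _ (by norm_num) fun k => ?_
    refine lp.norm_le_of_forall_sum_le (by simp) (by norm_num) fun S => ?_
    refine le_trans (le_of_eq ?_) ((hψ k S).trans (by simp))
    refine Finset.sum_congr rfl fun j _ => ?_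
    have : (((1 : lp (fun _ : ℕ => ℝ) 1 →L[ℝ] lp (fun _ : ℕ => ℝ) 1) - R ∘L T)
        (lp.single 1 k (1 : ℝ))) j = (if j = k then 1 else 0) - ψ j (x k) := by
      simp [hTe, hR, Pi.single_apply]
    rw [this, abs_sub_comm]
    simp
  have hunit : IsUnit (R ∘L T) := by
    have := isUnit_one_sub_of_norm_lt_one (x := 1 - R ∘L T) (by linarith)
    simpa using this
  obtain ⟨D, hDu⟩ := hunit
  have hcomp : ∀ u, (↑D⁻¹ : lp (fun _ : ℕ => ℝ) 1 →L[ℝ] lp (fun _ : ℕ => ℝ) 1) (R (T u)) = u := by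
    intro u
    have h := D.inv_mul
    rw [hDu] at h
    exact congrArg (fun A : lp (fun _ : ℕ => ℝ) 1 →L[ℝ] lp (fun _ : ℕ => ℝ) 1 => A u) h
  refine ⟨T ∘L (↑D⁻¹ : lp (fun _ : ℕ => ℝ) 1 →L[ℝ] lp (fun _ : ℕ => ℝ) 1) ∘L R, ?_, ?_⟩
  · intro f
    change T _ ∈ _
    rw [hT]
    rw [← SetLike.mem_coe, Submodule.topologicalClosure_coe]
    refine mem_closure_of_tendsto (hsum _).hasSum (Eventually.of_forall fun S => ?_)
    exact Submodule.sum_mem _ fun k _ => Submodule.smul_mem _ _ (Submodule.subset_span ⟨k, rfl⟩)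
  · set P := T ∘L (↑D⁻¹ : lp (fun _ : ℕ => ℝ) 1 →L[ℝ] lp (fun _ : ℕ => ℝ) 1) ∘L R with hP
    have hle : (Submodule.span ℝ (Set.range x)).topologicalClosure ≤
        LinearMap.ker ((P - ContinuousLinearMap.id ℝ E : E →L[ℝ] E) : E →ₗ[ℝ] E) := by
      refine Submodule.topologicalClosure_minimal _ ?_
        (ContinuousLinearMap.isClosed_ker (P - ContinuousLinearMap.id ℝ E))
      rw [Submodule.span_le]
      rintro _ ⟨k, rfl⟩
      have : P (x k) = x k := by
        rw [← hTe k]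
        change T ((↑D⁻¹ : lp (fun _ : ℕ => ℝ) 1 →L[ℝ] lp (fun _ : ℕ => ℝ) 1) (R (T _))) = _
        rw [hcomp]
      simp [this]
    intro f hf
    have := hle hf
    simpa [sub_eq_zero] using this

theorem le_norm_sum_of_almost_biorthogonal {E : Type*} [NormedAddCommGroup E]
    [NormedSpace ℝ E] (x : ℕ → E) (ψ : ℕ → E →L[ℝ] ℝ) {K : ℝ}
    (hK : ∀ (f : E) (S : Finset ℕ), ∑ j ∈ S, |ψ j f| ≤ K * ‖f‖)
    (hψ : ∀ (k : ℕ) (S : Finset ℕ), ∑ j ∈ S, |ψ j (x k) - if j = k then 1 else 0| ≤ 1 / 2)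
    (A : Finset ℕ) (lam : ℕ → ℝ) :
    1 / 2 * ∑ i ∈ A, |lam i| ≤ K * ‖∑ i ∈ A, lam i • x i‖ := by
  have h1 := hK (∑ i ∈ A, lam i • x i) A
  have h2 : ∀ j ∈ A, |lam j| ≤ |ψ j (∑ i ∈ A, lam i • x i)| +
      ∑ k ∈ A, |lam k| * |ψ j (x k) - if j = k then 1 else 0| := by
    intro j hj
    have h3 : lam j = ψ j (∑ i ∈ A, lam i • x i) -
        ∑ k ∈ A, lam k * (ψ j (x k) - if j = k then 1 else 0) := by
      simp only [map_sum, map_smul, smul_eq_mul, mul_sub, Finset.sum_sub_distrib]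
      simp [hj]
    calc |lam j| = |ψ j (∑ i ∈ A, lam i • x i) -
        ∑ k ∈ A, lam k * (ψ j (x k) - if j = k then 1 else 0)| := by rw [← h3]
      _ ≤ _ := (abs_sub _ _).trans (by
        gcongr
        refine (Finset.abs_sum_le_sum_abs _ _).trans (le_of_eq ?_)
        simp [abs_mul])
  have h4 := Finset.sum_le_sum h2
  rw [Finset.sum_add_distrib, Finset.sum_comm] at h4
  have h5 : ∑ k ∈ A, ∑ j ∈ A, |lam k| * |ψ j (x k) - if j = k then 1 else 0| ≤
      ∑ k ∈ A, |lam k| * (1 / 2) := by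
    refine Finset.sum_le_sum fun k _ => ?_
    rw [← Finset.mul_sum]
    gcongr
    exact hψ k A
  rw [← Finset.sum_mul] at h5
  linarith

theorem exists_injective_offdiagonal_sum_le {ε : ℝ} (hε : 0 ≤ ε) (n : ℕ) (a : ℕ → ℕ → ℝ)
    (ha : ∀ j k, 0 ≤ a j k) (hsum : ∀ k (S : Finset ℕ), ∑ j ∈ S, a j k ≤ n * ε) :
    ∃ σ : ℕ → ℕ, σ.Injective ∧
      ∀ k (S : Finset ℕ), k ∉ S → ∑ j ∈ S, a (σ j) (σ k) ≤ ε := by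
  induction n generalizing a with
  | zero => exact ⟨id, Function.injective_id, fun k S _ => (hsum k S).trans (by simpa using hε)⟩
  | succ n ih =>
    by_cases h : ∃ p, ∀ k (S : Finset ℕ), k ∉ S →
        ∑ j ∈ S, a (Nat.pair p j) (Nat.pair p k) ≤ ε
    · obtain ⟨p, hp⟩ := h
      exact ⟨Nat.pair p, fun i j hij => (Nat.pair_eq_pair.1 hij).2, hp⟩
    · push Not at h
      choose q S hqS hS using h
      have hinj : Function.Injective fun p => Nat.pair p (q p) :=
        fun i j hij => (Nat.pair_eq_pair.1 hij).1
      obtain ⟨σ, hσ, hσs⟩ := ih (fun j k => a (Nat.pair j (q j)) (Nat.pair k (q k)))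
        (fun _ _ => ha _ _) (by
          intro k A
          have hdisj : Disjoint (A.image fun p => Nat.pair p (q p))
              ((S k).image fun j => Nat.pair k j) := by
            rw [Finset.disjoint_left]
            intro m hm hm'
            obtain ⟨i, -, rfl⟩ := Finset.mem_image.1 hm
            obtain ⟨j, hj, hij⟩ := Finset.mem_image.1 hm'
            obtain ⟨rfl, rfl⟩ := Nat.pair_eq_pair.1 hij
            exact hqS _ hj
          have := hsum (Nat.pair k (q k)) ((A.image fun p => Nat.pair p (q p)) ∪
              ((S k).image fun j => Nat.pair k j))
          rw [Finset.sum_union hdisj, Finset.sum_image hinj.injOn,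
            Finset.sum_image (fun i _ j _ hij => (Nat.pair_eq_pair.1 hij).2)] at this
          have := hS k
          push_cast at *
          linarith)
      exact ⟨fun k => Nat.pair (σ k) (q (σ k)), hinj.comp hσ, hσs⟩

theorem exists_tendsto_ultrafilter_apply {E ι : Type*} [NormedAddCommGroup E]
    [NormedSpace ℝ E] (U : Ultrafilter ι) (φ : ι → E →L[ℝ] ℝ) {C : ℝ} (hφ : ∀ i, ‖φ i‖ ≤ C) :
    ∃ ψ : E →L[ℝ] ℝ, ∀ f, Tendsto (fun i => φ i f) U (𝓝 (ψ f)) := by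
  have hc := WeakDual.isCompact_closedBall (𝕜 := ℝ) (E := E) 0 C
  obtain ⟨ψ, -, hψ⟩ := hc.ultrafilter_le_nhds (U.map fun i => StrongDual.toWeakDual (φ i)) (by
    rw [le_principal_iff, Ultrafilter.mem_coe, Ultrafilter.mem_map]
    refine Filter.Eventually.of_forall fun i => ?_
    simpa using hφ i)
  refine ⟨WeakDual.toStrongDual ψ, fun f => ?_⟩
  exact ((WeakDual.eval_continuous f).tendsto ψ).comp hψ

theorem finiteDimensional_of_weighted_coordinates {X ι : Type*} [NormedAddCommGroup X]
    [NormedSpace ℝ X] (U : Ultrafilter ι) {d : ι → ℕ} (t : ∀ s, Fin (d s) → X →L[ℝ] ℝ)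
    (ht : ∀ s i, ‖t s i‖ ≤ 1) (w : ∀ s, Fin (d s) → ℝ) (hw : ∀ s i, 0 ≤ w s i) {W c : ℝ}
    (hW : ∀ s, ∑ i, w s i ≤ W) (hc : 0 < c)
    (hlow : ∀ x : X, ∀ᶠ s in (U : Filter ι), c * ‖x‖ ^ 2 ≤ ∑ i, w s i * (t s i x * t s i x)) :
    FiniteDimensional ℝ X := by
  have htx : ∀ s i x, |t s i x| ≤ ‖x‖ := fun s i x => by
    simpa using (t s i).le_of_opNorm_le (ht s i) x
  have hex : ∀ x z : X, ∃ l : ℝ,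
      Tendsto (fun s => ∑ i, w s i * (t s i x * t s i z)) U (𝓝 l) := by
    intro x z
    obtain ⟨l, -, hl⟩ := (isCompact_Icc (a := -(W * (‖x‖ * ‖z‖))) (b := W * (‖x‖ * ‖z‖))
      ).ultrafilter_le_nhds (U.map fun s => ∑ i, w s i * (t s i x * t s i z)) (by
        rw [le_principal_iff, Ultrafilter.mem_coe, Ultrafilter.mem_map]
        refine Filter.Eventually.of_forall fun s => ?_
        refine abs_le.1 ?_
        calc _ ≤ ∑ i, |w s i * (t s i x * t s i z)| := Finset.abs_sum_le_sum_abs _ _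
          _ ≤ ∑ i, w s i * (‖x‖ * ‖z‖) := by
            gcongr with i
            rw [abs_mul, abs_mul, abs_of_nonneg (hw s i)]
            have := hw s i
            gcongr
            · exact htx s i x
            · exact htx s i z
          _ = (∑ i, w s i) * (‖x‖ * ‖z‖) := by rw [Finset.sum_mul]
          _ ≤ _ := by gcongr; exact hW s)
    exact ⟨l, hl⟩
  choose B₀ hB₀ using hex
  let B : X →ₗ[ℝ] X →ₗ[ℝ] ℝ := LinearMap.mk₂ ℝ B₀
    (fun x x' z => tendsto_nhds_unique (hB₀ _ _) (by
      simpa [add_mul, mul_add, Finset.sum_add_distrib] using (hB₀ x z).add (hB₀ x' z)))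
    (fun r x z => tendsto_nhds_unique (hB₀ _ _) (by
      refine ((hB₀ x z).const_mul r).congr fun s => ?_
      rw [Finset.mul_sum]
      refine Finset.sum_congr rfl fun i _ => ?_
      simp only [map_smul, smul_eq_mul]; ring))
    (fun x z z' => tendsto_nhds_unique (hB₀ _ _) (by
      simpa [add_mul, mul_add, Finset.sum_add_distrib] using (hB₀ x z).add (hB₀ x z')))
    (fun r x z => tendsto_nhds_unique (hB₀ _ _) (by
      refine ((hB₀ x z).const_mul r).congr fun s => ?_
      rw [Finset.mul_sum]
      refine Finset.sum_congr rfl fun i _ => ?_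
      simp only [map_smul, smul_eq_mul]; ring))
  have hB : ∀ x z, Tendsto (fun s => ∑ i, w s i * (t s i x * t s i z)) U (𝓝 (B x z)) := hB₀
  have hsymm : ∀ x z, B x z = B z x := fun x z =>
    tendsto_nhds_unique (hB x z) ((hB z x).congr fun s => by simp only [mul_comm])
  have hpos : ∀ x, c * ‖x‖ ^ 2 ≤ B x x := fun x => ge_of_tendsto (hB x x) (hlow x)
  by_contra hinf
  have hon : ∀ n : ℕ, ∃ e : Fin n → X, ∀ j k, B (e j) (e k) = if j = k then 1 else 0 := by
    intro n
    induction n with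
    | zero => exact ⟨fun j => j.elim0, fun j => j.elim0⟩
    | succ n ih =>
      obtain ⟨e, he⟩ := ih
      let L : X →ₗ[ℝ] (Fin n → ℝ) := LinearMap.pi fun j => B (e j)
      have hL : ¬ Function.Injective L := fun h => hinf (FiniteDimensional.of_injective L h)
      rw [← LinearMap.ker_eq_bot, Submodule.eq_bot_iff] at hL
      push Not at hL
      obtain ⟨v, hv, hv0⟩ := hL
      have hvj : ∀ j, B (e j) v = 0 := fun j => congrFun (LinearMap.mem_ker.1 hv) j
      have hvv : 0 < B v v := lt_of_lt_of_le (by positivity) (hpos v)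
      refine ⟨Fin.snoc (α := fun _ => X) e ((Real.sqrt (B v v))⁻¹ • v), fun j k => ?_⟩
      have hsq : (Real.sqrt (B v v))⁻¹ * ((Real.sqrt (B v v))⁻¹ * B v v) = 1 := by
        have h1 := Real.mul_self_sqrt hvv.le
        have h2 : Real.sqrt (B v v) ≠ 0 := (Real.sqrt_pos.2 hvv).ne'
        field_simp
        nlinarith
      induction j using Fin.lastCases with
      | last =>
        induction k using Fin.lastCases with
        | last => simpa using hsq
        | cast k => simp [hsymm v, hvj, (Fin.castSucc_lt_last k).ne']
      | cast j =>
        induction k using Fin.lastCases with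
        | last => simp [hvj, (Fin.castSucc_lt_last j).ne]
        | cast k => simp [he]
  obtain ⟨n, hn⟩ := exists_nat_gt (W * c⁻¹)
  obtain ⟨e, he⟩ := hon n
  have hq : ∀ s i, ∑ k, t s i (e k) * t s i (e k) ≤ c⁻¹ := by
    intro s i
    set q := ∑ k, t s i (e k) * t s i (e k) with hqdef
    set x := ∑ k, t s i (e k) • e k with hx
    have h1 : t s i x = q := by simp [hx, hqdef]
    have h2 : B x x = q := by
      simp [hx, hqdef, he]
    have h3 := hpos x
    have h4 := htx s i x
    rw [h1] at h4
    rw [h2] at h3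
    have h5 : 0 ≤ q := Finset.sum_nonneg fun k _ => mul_self_nonneg _
    rw [abs_of_nonneg h5] at h4
    have h6 : c * q ^ 2 ≤ q := le_trans (by gcongr) h3
    by_contra! h7
    have h8 : 0 < q := lt_trans (by positivity) h7
    have h9 : c * q ≤ 1 := by nlinarith
    have h10 : 1 < c * q := by
      have := mul_lt_mul_of_pos_left h7 hc
      rwa [mul_inv_cancel₀ hc.ne'] at this
    linarith
  have hlim : Tendsto (fun s => ∑ k, ∑ i, w s i * (t s i (e k) * t s i (e k))) U (𝓝 (n : ℝ)) := by
    have := tendsto_finsetSum (Finset.univ : Finset (Fin n)) fun k _ => hB (e k) (e k)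
    simpa [he] using this
  have : (n : ℝ) ≤ W * c⁻¹ := le_of_tendsto hlim (Eventually.of_forall fun s => by
    rw [Finset.sum_comm]
    calc _ = ∑ i, w s i * ∑ k, t s i (e k) * t s i (e k) := by simp only [Finset.mul_sum]
      _ ≤ ∑ i, w s i * c⁻¹ := by
        gcongr with i
        · exact hw s i
        · exact hq s i
      _ = (∑ i, w s i) * c⁻¹ := by rw [Finset.sum_mul]
      _ ≤ _ := by gcongr; exact hW s)
  linarith

theorem finiteDimensional_of_uniform_smallness {X ι : Type*} [NormedAddCommGroup X]
    [NormedSpace ℝ X] (U : Ultrafilter ι) {d : ι → ℕ} (t : ∀ s, Fin (d s) → X →L[ℝ] ℝ)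
    (y : ∀ s, Fin (d s) → X) (ht : ∀ s i, ‖t s i‖ ≤ 1) {C : ℝ} (hC : 0 ≤ C)
    (hy : ∀ s (f : X →L[ℝ] ℝ), ∑ i, |f (y s i)| ≤ C * ‖f‖)
    (hty : ∀ x, ∀ᶠ s in (U : Filter ι), x = ∑ i, t s i x • y s i)
    (F : Finset (X →L[ℝ] ℝ)) {δ : ℝ} (hδ : 0 < δ)
    (hF : ∀ (A : ∀ s, Finset (Fin (d s))) (g : X →L[ℝ] ℝ), ‖g‖ ≤ 1 →
      (∀ f ∈ F, ∀ᶠ s in (U : Filter ι), ∑ i ∈ A s, |f (y s i)| < δ) →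
      ∀ᶠ s in (U : Filter ι), ∑ i ∈ A s, |g (y s i)| ≤ 1 / 2) :
    FiniteDimensional ℝ X := by
  have htx : ∀ s i x, |t s i x| ≤ ‖x‖ := fun s i x => by
    simpa using (t s i).le_of_opNorm_le (ht s i) x
  have hwnn : ∀ s i, 0 ≤ ∑ f ∈ F, |f (y s i)| := fun s i =>
    Finset.sum_nonneg fun f _ => abs_nonneg _
  refine finiteDimensional_of_weighted_coordinates U t ht (fun s i => ∑ f ∈ F, |f (y s i)|)
    hwnn (W := ∑ f ∈ F, C * ‖f‖) (c := δ * (1 / (4 * (C + 1))) ^ 2)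
    (fun s => ?_) (by positivity) fun x => ?_
  · rw [Finset.sum_comm]
    exact Finset.sum_le_sum fun f _ => hy s f
  · rcases eq_or_ne x 0 with rfl | hx
    · simp
    have hx' : 0 < ‖x‖ := norm_pos_iff.2 hx
    obtain ⟨g, hg1, hgx⟩ := exists_dual_vector'' ℝ x
    simp only [RCLike.ofReal_real_eq_id, id_eq] at hgx
    set τ := 1 / (4 * (C + 1)) * ‖x‖ with hτ
    have hτ0 : 0 < τ := by positivity
    have hτC : τ * C ≤ ‖x‖ / 4 := by
      rw [hτ]; field_simp; nlinarith
    let A : ∀ s, Finset (Fin (d s)) := fun s => Finset.univ.filter fun i => τ < |t s i x|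
    have hlarge : ∀ᶠ s in (U : Filter ι), 1 / 2 < ∑ i ∈ A s, |g (y s i)| := by
      filter_upwards [hty x] with s hs
      have h1 : ‖x‖ ≤ ∑ i, |t s i x| * |g (y s i)| := by
        rw [← hgx]
        conv_lhs => rw [hs]
        rw [map_sum]
        refine (le_abs_self _).trans ((Finset.abs_sum_le_sum_abs _ _).trans (le_of_eq ?_))
        simp [abs_mul]
      rw [← Finset.sum_filter_add_sum_filter_not Finset.univ (fun i => τ < |t s i x|)] at h1
      have h2 : ∑ i with τ < |t s i x|, |t s i x| * |g (y s i)| ≤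
          ‖x‖ * ∑ i ∈ A s, |g (y s i)| := by
        rw [Finset.mul_sum]
        exact Finset.sum_le_sum fun i _ => by gcongr; exact htx s i x
      have h3 : ∑ i with ¬ τ < |t s i x|, |t s i x| * |g (y s i)| ≤ τ * C := by
        calc _ ≤ ∑ i with ¬ τ < |t s i x|, τ * |g (y s i)| :=
              Finset.sum_le_sum fun i hi => by
                gcongr
                exact not_lt.1 (Finset.mem_filter.1 hi).2
          _ ≤ ∑ i, τ * |g (y s i)| :=
              Finset.sum_le_sum_of_subset_of_nonneg (Finset.filter_subset _ _)
                fun i _ _ => by positivity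
          _ = τ * ∑ i, |g (y s i)| := by rw [Finset.mul_sum]
          _ ≤ τ * C := by
              gcongr
              exact (hy s g).trans (by nlinarith)
      by_contra! h4
      nlinarith
    have hnot : ¬ ∀ f ∈ F, ∀ᶠ s in (U : Filter ι), ∑ i ∈ A s, |f (y s i)| < δ := fun h => by
      obtain ⟨s, hs1, hs2⟩ := ((hF A g hg1 h).and hlarge).exists
      linarith
    push Not at hnot
    obtain ⟨f, hf, hfs⟩ := hnot
    filter_upwards [hfs] with s hs
    have hsum : δ ≤ ∑ i ∈ A s, ∑ f ∈ F, |f (y s i)| := hs.trans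
      (Finset.sum_le_sum fun i _ => Finset.single_le_sum
        (f := fun f : X →L[ℝ] ℝ => |f (y s i)|) (fun _ _ => abs_nonneg _) hf)
    calc δ * (1 / (4 * (C + 1))) ^ 2 * ‖x‖ ^ 2 = δ * τ ^ 2 := by rw [hτ]; ring
      _ ≤ (∑ i ∈ A s, ∑ f ∈ F, |f (y s i)|) * τ ^ 2 := by gcongr
      _ = ∑ i ∈ A s, (∑ f ∈ F, |f (y s i)|) * τ ^ 2 := by rw [Finset.sum_mul]
      _ ≤ ∑ i ∈ A s, (∑ f ∈ F, |f (y s i)|) * (t s i x * t s i x) := by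
        refine Finset.sum_le_sum fun i hi => mul_le_mul_of_nonneg_left ?_ (hwnn s i)
        have := (Finset.mem_filter.1 hi).2
        rw [← abs_mul_abs_self (t s i x)]
        nlinarith
      _ ≤ _ := Finset.sum_le_sum_of_subset_of_nonneg (Finset.subset_univ _)
        fun i _ _ => mul_nonneg (hwnn s i) (mul_self_nonneg _)

theorem IsLinftyCSpace.exists_coordinates {X : Type*} [NormedAddCommGroup X] [NormedSpace ℝ X]
    {C : ℝ} (hC : 0 ≤ C) (hX : IsLinftyCSpace X C) (s : Finset X) :
    ∃ (d : ℕ) (t : Fin d → X →L[ℝ] ℝ) (y : Fin d → X), (∀ i, ‖t i‖ ≤ 1) ∧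
      (∀ f : X →L[ℝ] ℝ, ∑ i, |f (y i)| ≤ C * ‖f‖) ∧ ∀ x ∈ s, x = ∑ i, t i x • y i := by
  obtain ⟨G, hG, n, T, hT⟩ : ∃ G : Submodule ℝ X, Submodule.span ℝ (s : Set X) ≤ G ∧
      ∃ (n : ℕ) (T : G ≃L[ℝ] (Fin n → ℝ)), ‖(T : G →L[ℝ] (Fin n → ℝ))‖ *
        ‖(T.symm : (Fin n → ℝ) →L[ℝ] G)‖ ≤ C := by
    obtain ⟨G, hG, -, T, hT⟩ := hX (Submodule.span ℝ (s : Set X)) inferInstance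
    exact ⟨G, hG, _, T, hT⟩
  set τ := ‖(T : G →L[ℝ] (Fin n → ℝ))‖ with hτ
  have hsG : ∀ x ∈ s, x ∈ G := fun x hx => hG (Submodule.subset_span hx)
  rcases eq_or_ne τ 0 with h0 | h0
  · refine ⟨0, fun i => i.elim0, fun i => i.elim0, fun i => i.elim0,
      fun f => by simpa using by positivity, fun x hx => ?_⟩
    have h1 : (T : G →L[ℝ] (Fin n → ℝ)) = 0 :=
      ContinuousLinearMap.opNorm_zero_iff _ |>.1 h0
    have h2 : T ⟨x, hsG x hx⟩ = 0 := congrArg (fun A : G →L[ℝ] (Fin n → ℝ) => A ⟨x, hsG x hx⟩) h1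
    have h3 : (⟨x, hsG x hx⟩ : G) = 0 := by simpa using h2
    simpa using congrArg Subtype.val h3
  have hτ0 : 0 < τ := lt_of_le_of_ne (ContinuousLinearMap.opNorm_nonneg _) h0.symm
  have hext : ∀ i : Fin n, ∃ g : X →L[ℝ] ℝ, (∀ x : G, g x = τ⁻¹ * T x i) ∧ ‖g‖ ≤ 1 := by
    intro i
    obtain ⟨g, hg, hgn⟩ := exists_extension_norm_eq G
      (τ⁻¹ • (ContinuousLinearMap.proj i ∘L (T : G →L[ℝ] (Fin n → ℝ))))
    refine ⟨g, fun x => by simpa using hg x, hgn.trans_le ?_⟩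
    refine ContinuousLinearMap.opNorm_le_bound _ zero_le_one fun x => ?_
    have h1 : ‖T x i‖ ≤ τ * ‖x‖ :=
      (norm_le_pi_norm (T x) i).trans ((T : G →L[ℝ] (Fin n → ℝ)).le_opNorm x)
    have h2 : ‖τ⁻¹ * T x i‖ ≤ 1 * ‖x‖ := by
      rw [norm_mul, norm_inv, Real.norm_of_nonneg hτ0.le, inv_mul_le_iff₀ hτ0]
      simpa using h1
    simpa using h2
  choose t ht ht1 using hext
  refine ⟨n, t, fun i => τ • (T.symm (Pi.single i 1) : G), ht1, fun f => ?_, fun x hx => ?_⟩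
  · have hsum : ∑ i, |f (τ • (T.symm (Pi.single i 1) : G))| =
        τ * f (T.symm (fun i => (SignType.sign (f (T.symm (Pi.single i 1) : G)) : ℝ)) : G) := by
      set σ : Fin n → ℝ := fun i => (SignType.sign (f (T.symm (Pi.single i 1) : G)) : ℝ)
      have : σ = ∑ i, σ i • Pi.single i (1 : ℝ) := by
        ext j; simp [Finset.sum_apply, Pi.single_apply]
      rw [this]
      simp only [map_sum, map_smul, Submodule.coe_sum, Submodule.coe_smul, smul_eq_mul,
        Finset.mul_sum, abs_mul, abs_of_pos hτ0]
      refine Finset.sum_congr rfl fun i _ => ?_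
      rw [sign_mul_self]
    rw [hsum]
    set σ : Fin n → ℝ := fun i => (SignType.sign (f (T.symm (Pi.single i 1) : G)) : ℝ)
    have hσ : ‖σ‖ ≤ 1 := (pi_norm_le_iff_of_nonneg zero_le_one).2 fun i => by
      rcases SignType.trichotomy (SignType.sign (f (T.symm (Pi.single i 1) : G))) with h | h | h <;>
        simp [σ, h]
    have h1 : ‖(T.symm σ : G)‖ ≤ ‖(T.symm : (Fin n → ℝ) →L[ℝ] G)‖ :=
      (T.symm : (Fin n → ℝ) →L[ℝ] G).unit_le_opNorm σ hσ
    calc τ * f (T.symm σ : G) ≤ τ * (‖f‖ * ‖(T.symm : (Fin n → ℝ) →L[ℝ] G)‖) := by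
          gcongr
          exact (le_abs_self _).trans ((f.le_opNorm _).trans (by gcongr; exact h1))
      _ = (τ * ‖(T.symm : (Fin n → ℝ) →L[ℝ] G)‖) * ‖f‖ := by ring
      _ ≤ C * ‖f‖ := by gcongr
  · lift x to G using hsG x hx
    have h1 : x = ∑ i, T x i • T.symm (Pi.single i 1) := by
      apply T.injective
      ext j
      simp [Finset.sum_apply, Pi.single_apply]
    have h2 : (x : X) = ∑ i, T x i • (T.symm (Pi.single i 1) : X) := by
      conv_lhs => rw [h1]
      simp
    simp only [ht, smul_smul]
    conv_lhs => rw [h2]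
    refine Finset.sum_congr rfl fun i _ => ?_
    congr 1
    field_simp

theorem Finset.sum_biUnion_le_sum_of_nonneg {α β : Type*} [DecidableEq β] (S : Finset α)
    (A : α → Finset β) {v : β → ℝ} (hv : ∀ i, 0 ≤ v i) :
    ∑ i ∈ S.biUnion A, v i ≤ ∑ j ∈ S, ∑ i ∈ A j, v i := by
  classical
  induction S using Finset.induction_on with
  | empty => simp
  | insert a S ha ih =>
    rw [Finset.biUnion_insert, Finset.sum_insert ha]
    have := Finset.sum_union_inter (s₁ := A a) (s₂ := S.biUnion A) (f := v)
    have := Finset.sum_nonneg fun i (_ : i ∈ A a ∩ S.biUnion A) => hv i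
    linarith

theorem exists_weakly_unconditionally_cauchy {X ι : Type*} [NormedAddCommGroup X]
    [NormedSpace ℝ X] (U : Ultrafilter ι) {d : ι → ℕ} (y : ∀ s, Fin (d s) → X) {C : ℝ}
    (hC : 0 ≤ C) (hy : ∀ s (f : X →L[ℝ] ℝ), ∑ i, |f (y s i)| ≤ C * ‖f‖)
    (h : ∀ (F : Finset (X →L[ℝ] ℝ)) (δ : ℝ), 0 < δ →
      ∃ (A : ∀ s, Finset (Fin (d s))) (g : X →L[ℝ] ℝ), ‖g‖ ≤ 1 ∧
        (∀ f ∈ F, ∀ᶠ s in (U : Filter ι), ∑ i ∈ A s, |f (y s i)| < δ) ∧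
        ∀ᶠ s in (U : Filter ι), 1 / 2 < ∑ i ∈ A s, |g (y s i)|) :
    ∃ (φ : ℕ → (X →L[ℝ] ℝ) →L[ℝ] ℝ) (g : ℕ → X →L[ℝ] ℝ),
      (∀ f (S : Finset ℕ), ∑ k ∈ S, |φ k f| ≤ C * ‖f‖) ∧ (∀ k, ‖g k‖ ≤ 1) ∧
      ∀ k, 1 / 4 ≤ φ k (g k) := by
  classical
  obtain ⟨p, hp, hpr⟩ := exists_seq_of_forall_finset_exists
    (α := (∀ s, Finset (Fin (d s))) × (X →L[ℝ] ℝ) × ℝ)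
    (fun p => ‖p.2.1‖ ≤ 1 ∧ 0 < p.2.2 ∧ p.2.2 ≤ 1 / 8 ∧
      ∀ᶠ s in (U : Filter ι), 1 / 2 < ∑ i ∈ p.1 s, |p.2.1 (y s i)|)
    (fun p q => q.2.2 ≤ p.2.2 / 2 ∧
      ∀ᶠ s in (U : Filter ι), ∑ i ∈ q.1 s, |p.2.1 (y s i)| < q.2.2) (by
      intro S hS
      have hδ : ∀ᶠ δ in 𝓝[>] (0 : ℝ), 0 < δ ∧ δ ≤ 1 / 8 ∧ ∀ p ∈ S, δ ≤ p.2.2 / 2 := by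
        refine (eventually_mem_nhdsWithin).and (Eventually.and ?_ ?_)
        · exact eventually_nhdsWithin_of_eventually_nhds (eventually_le_nhds (by norm_num))
        · rw [Finset.eventually_all]
          exact fun p hp => eventually_nhdsWithin_of_eventually_nhds
            (eventually_le_nhds (half_pos (hS p hp).2.1))
      obtain ⟨δ, hδ0, hδ1, hδS⟩ := hδ.exists
      obtain ⟨A, g, hg, hA, hAg⟩ := h (S.image fun p => p.2.1) δ hδ0
      exact ⟨(A, g, δ), ⟨hg, hδ0, hδ1, hAg⟩, fun p hp =>
        ⟨hδS p hp, hA _ (Finset.mem_image_of_mem _ hp)⟩⟩)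
  set A := fun k => (p k).1 with hAdef
  set g := fun k => (p k).2.1 with hgdef
  set δ := fun k => (p k).2.2 with hδdef
  have hδ : ∀ k, δ k ≤ (1 / 2) ^ k * (1 / 8) := by
    intro k
    induction k with
    | zero => simpa using (hp 0).2.2.1
    | succ k ih =>
      have := (hpr k (k + 1) (Nat.lt_succ_self k)).1
      change δ (k + 1) ≤ δ k / 2 at this
      rw [pow_succ]
      linarith
  have hδsum : ∀ k n, ∑ j ∈ Finset.Ioc k n, δ j ≤ 1 / 4 := by
    intro k n
    calc ∑ j ∈ Finset.Ioc k n, δ j ≤ ∑ j ∈ Finset.Ioc k n, (1 / 2 : ℝ) ^ j * (1 / 8) :=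
          Finset.sum_le_sum fun j _ => hδ j
      _ ≤ ∑ j ∈ Finset.range (n + 1), (1 / 2 : ℝ) ^ j * (1 / 8) := by
          refine Finset.sum_le_sum_of_subset_of_nonneg (fun j hj => ?_)
            fun j _ _ => by positivity
          rw [Finset.mem_Ioc] at hj
          exact Finset.mem_range.2 (by omega)
      _ = (∑ j ∈ Finset.range (n + 1), (1 / 2 : ℝ) ^ j) * (1 / 8) := by rw [Finset.sum_mul]
      _ ≤ 2 * (1 / 8) := by gcongr; exact sum_geometric_two_le _
      _ = 1 / 4 := by norm_num
  let B : ℕ → ℕ → ∀ s, Finset (Fin (d s)) := fun k n s =>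
    A k s \ (Finset.Ioc k n).biUnion fun j => A j s
  let z : ℕ → ℕ → ι → X := fun k n s =>
    ∑ i ∈ B k n s, (SignType.sign (g k (y s i)) : ℝ) • y s i
  have hz : ∀ k n s (f : X →L[ℝ] ℝ), |f (z k n s)| ≤ ∑ i ∈ B k n s, |f (y s i)| := by
    intro k n s f
    simp only [z, map_sum, map_smul, smul_eq_mul]
    refine (Finset.abs_sum_le_sum_abs _ _).trans (Finset.sum_le_sum fun i _ => ?_)
    rw [abs_mul]
    refine mul_le_of_le_one_left (abs_nonneg _) ?_
    rcases SignType.trichotomy (SignType.sign (g k (y s i))) with h | h | h <;> simp [h]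
  have hsub : ∀ s (f : X →L[ℝ] ℝ) (S : Finset (Fin (d s))), ∑ i ∈ S, |f (y s i)| ≤ C * ‖f‖ :=
    fun s f S => (Finset.sum_le_sum_of_subset_of_nonneg (Finset.subset_univ _)
      fun _ _ _ => abs_nonneg _).trans (hy s f)
  have hlim : ∀ k n, ∃ ψ : (X →L[ℝ] ℝ) →L[ℝ] ℝ, ∀ f : X →L[ℝ] ℝ,
      Tendsto (fun s => f (z k n s)) U (𝓝 (ψ f)) := by
    intro k n
    exact exists_tendsto_ultrafilter_apply U
      (fun s => ContinuousLinearMap.apply ℝ ℝ (z k n s)) (C := C) fun s =>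
      ContinuousLinearMap.opNorm_le_bound _ hC fun f => (hz k n s f).trans (hsub s f _)
  choose Φ hΦ using hlim
  have hΦsum : ∀ n f (S : Finset ℕ), (∀ k ∈ S, k ≤ n) → ∑ k ∈ S, |Φ k n f| ≤ C * ‖f‖ := by
    intro n f S hS
    refine le_of_tendsto (tendsto_finsetSum S fun k _ => (hΦ k n f).abs)
      (Eventually.of_forall fun s => ?_)
    have hdisj : (S : Set ℕ).PairwiseDisjoint fun k => B k n s := by
      have hlt : ∀ k l, k < l → l ≤ n → Disjoint (B k n s) (B l n s) := by
        intro k l hkl hl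
        refine Finset.disjoint_left.2 fun i hi hi' => ?_
        refine (Finset.mem_sdiff.1 hi).2 (Finset.mem_biUnion.2
          ⟨l, Finset.mem_Ioc.2 ⟨hkl, hl⟩, (Finset.mem_sdiff.1 hi').1⟩)
      intro k hk l hl hkl
      rcases lt_or_gt_of_ne hkl with h | h
      · exact hlt k l h (hS l hl)
      · exact (hlt l k h (hS k hk)).symm
    calc ∑ k ∈ S, |f (z k n s)| ≤ ∑ k ∈ S, ∑ i ∈ B k n s, |f (y s i)| :=
          Finset.sum_le_sum fun k _ => hz k n s f
      _ = ∑ i ∈ S.biUnion fun k => B k n s, |f (y s i)| := (Finset.sum_biUnion hdisj).symm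
      _ ≤ C * ‖f‖ := hsub s f _
  have hΦg : ∀ k n, 1 / 4 ≤ Φ k n (g k) := by
    intro k n
    refine ge_of_tendsto (hΦ k n (g k)) ?_
    have hev : ∀ᶠ s in (U : Filter ι), ∀ j ∈ Finset.Ioc k n,
        ∑ i ∈ A j s, |g k (y s i)| < δ j := by
      rw [Finset.eventually_all]
      exact fun j hj => (hpr k j (Finset.mem_Ioc.1 hj).1).2
    filter_upwards [hev, (hp k).2.2.2] with s hs hs'
    have h1 : g k (z k n s) = ∑ i ∈ B k n s, |g k (y s i)| := by
      simp [z]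
    rw [h1]
    have h2 : ∑ i ∈ A k s, |g k (y s i)| ≤ ∑ i ∈ B k n s, |g k (y s i)| +
        ∑ i ∈ (Finset.Ioc k n).biUnion fun j => A j s, |g k (y s i)| := by
      rw [← Finset.sum_union Finset.sdiff_disjoint]
      refine Finset.sum_le_sum_of_subset_of_nonneg ?_ fun _ _ _ => abs_nonneg _
      simp only [Finset.sdiff_union_self_eq_union]
      exact Finset.subset_union_left
    have h3 : ∑ i ∈ (Finset.Ioc k n).biUnion fun j => A j s, |g k (y s i)| ≤
        ∑ j ∈ Finset.Ioc k n, ∑ i ∈ A j s, |g k (y s i)| :=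
      Finset.sum_biUnion_le_sum_of_nonneg _ _ fun _ => abs_nonneg _
    have h4 := Finset.sum_le_sum fun j hj => (hs j hj).le
    have h5 := hδsum k n
    have h6 : 1 / 2 < ∑ i ∈ A k s, |g k (y s i)| := hs'
    linarith
  have hbound : ∀ k n, ‖Φ k (max k n)‖ ≤ C := fun k n =>
    ContinuousLinearMap.opNorm_le_bound _ hC fun f => by
      simpa using hΦsum (max k n) f {k} (by simp)
  choose φ hφ using fun k =>
    exists_tendsto_ultrafilter_apply (hyperfilter ℕ) (fun n => Φ k (max k n)) (hbound k)
  refine ⟨φ, g, fun f S => ?_, fun k => (hp k).1, fun k =>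
    ge_of_tendsto (hφ k (g k)) (Eventually.of_forall fun n => hΦg k _)⟩
  refine le_of_tendsto (tendsto_finsetSum S fun k _ => (hφ k f).abs) ?_
  have hev : ∀ᶠ n in (hyperfilter ℕ : Filter ℕ), ∀ k ∈ S, k ≤ n := by
    rw [Finset.eventually_all]
    exact fun k _ => Nat.hyperfilter_le_atTop (eventually_ge_atTop k)
  filter_upwards [hev] with n hn
  calc ∑ k ∈ S, |Φ k (max k n) f| = ∑ k ∈ S, |Φ k n f| :=
        Finset.sum_congr rfl fun k hk => by rw [max_eq_right (hn k hk)]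
    _ ≤ C * ‖f‖ := hΦsum n f S hn

theorem exists_norming_sequence (X : Type*) [NormedAddCommGroup X] [NormedSpace ℝ X]
    [TopologicalSpace.SeparableSpace X] :
    ∃ f : ℕ → X →L[ℝ] ℝ, (∀ i, ‖f i‖ ≤ 1) ∧ ∀ x, ∃ i, 1 / 2 * ‖x‖ ≤ |f i x| := by
  choose f hf1 hf using fun i => exists_dual_vector'' ℝ (TopologicalSpace.denseSeq X i)
  refine ⟨f, hf1, fun x => ?_⟩
  rcases eq_or_ne x 0 with rfl | hx
  · exact ⟨0, by simp⟩
  have hx' : 0 < ‖x‖ := norm_pos_iff.2 hx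
  obtain ⟨i, hi⟩ := (TopologicalSpace.denseRange_denseSeq X).exists_dist_lt x
    (show 0 < ‖x‖ / 4 by positivity)
  refine ⟨i, ?_⟩
  set u := TopologicalSpace.denseSeq X i
  rw [dist_eq_norm] at hi
  have h1 : f i u = ‖u‖ := hf i
  have h2 : |f i (x - u)| ≤ ‖x - u‖ := by simpa using (f i).le_of_opNorm_le (hf1 i) (x - u)
  have h3 : ‖x‖ ≤ ‖u‖ + ‖x - u‖ := by simpa using norm_add_le u (x - u)
  rw [map_sub, h1] at h2
  have h4 := (abs_le.1 h2).1
  have h5 := le_abs_self (f i x)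
  linarith

theorem exists_weakStar_null_almost_biorthogonal {X : Type*} [NormedAddCommGroup X]
    [NormedSpace ℝ X] [TopologicalSpace.SeparableSpace X]
    (φ : ℕ → (X →L[ℝ] ℝ) →L[ℝ] ℝ) (f : ℕ → X →L[ℝ] ℝ) {C η : ℝ} (hη : 0 < η)
    (hφ : ∀ g (S : Finset ℕ), ∑ k ∈ S, |φ k g| ≤ C * ‖g‖) (hf : ∀ k, ‖f k‖ ≤ 1)
    (hφf : ∀ k, η ≤ φ k (f k)) :
    ∃ (ψ : ℕ → (X →L[ℝ] ℝ) →L[ℝ] ℝ) (g : ℕ → X →L[ℝ] ℝ),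
      (∀ h (S : Finset ℕ), ∑ k ∈ S, |ψ k h| ≤ C * ‖h‖) ∧ (∀ k, ‖g k‖ ≤ 2) ∧
      (∀ k, 9 / 10 * η ≤ ψ k (g k)) ∧
      (∀ k (S : Finset ℕ), k ∉ S → ∑ j ∈ S, |ψ j (g k)| ≤ η / 5) ∧
      ∀ x, Tendsto (fun k => g k x) atTop (𝓝 0) := by
  have hC : 0 ≤ C := by
    have h1 := hφ (f 0) {0}
    rw [Finset.sum_singleton] at h1
    have h2 := hη.trans_le ((hφf 0).trans (le_abs_self _))
    by_contra! h3
    nlinarith [norm_nonneg (f 0)]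
  obtain ⟨n, hn⟩ := exists_nat_ge (C / (η / 10))
  rw [div_le_iff₀ (by positivity)] at hn
  obtain ⟨σ, hσ, hσs⟩ := exists_injective_offdiagonal_sum_le (ε := η / 10) (by positivity) n
    (fun j k => |φ j (f k)|) (fun _ _ => abs_nonneg _) fun k S =>
      (hφ (f k) S).trans ((mul_le_of_le_one_right hC (hf k)).trans hn)
  obtain ⟨f₀, -, τ, hτ, hlim⟩ := WeakDual.isSeqCompact_closedBall ℝ X 0 1
    (x := fun k => StrongDual.toWeakDual (f (σ k))) fun k => by simpa using hf (σ k)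
  have hlimx : ∀ x, Tendsto (fun k => f (σ (τ k)) x) atTop (𝓝 (f₀ x)) := fun x =>
    ((WeakDual.eval_continuous x).tendsto f₀).comp hlim
  have hinj : Function.Injective (fun k => τ (2 * k)) := fun i j h => by
    have := hτ.injective h
    omega
  have hoff : ∀ (m : ℕ) (S : Finset ℕ), (∀ j ∈ S, 2 * j ≠ m) →
      ∑ j ∈ S, |φ (σ (τ (2 * j))) (f (σ (τ m)))| ≤ η / 10 := by
    intro m S hS
    have := hσs (τ m) (S.image fun k => τ (2 * k)) (by
      rw [Finset.mem_image]
      rintro ⟨j, hj, hjm⟩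
      exact hS j hj (hτ.injective hjm))
    rwa [Finset.sum_image hinj.injOn] at this
  refine ⟨fun k => φ (σ (τ (2 * k))), fun k => f (σ (τ (2 * k))) - f (σ (τ (2 * k + 1))),
    fun h S => ?_, fun k => ?_, fun k => ?_, fun k S hk => ?_, fun x => ?_⟩
  · have := hφ h (S.image fun k => σ (τ (2 * k)))
    rwa [Finset.sum_image fun i _ j _ hij => hinj (hσ hij)] at this
  · exact (norm_sub_le _ _).trans (by linarith [hf (σ (τ (2 * k))), hf (σ (τ (2 * k + 1)))])
  · have h1 := hφf (σ (τ (2 * k)))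
    have h2 := hoff (2 * k + 1) {k} (by simp)
    rw [Finset.sum_singleton] at h2
    have h3 := (abs_le.1 h2).2
    rw [map_sub]
    linarith
  · calc ∑ j ∈ S, |φ (σ (τ (2 * j))) (f (σ (τ (2 * k))) - f (σ (τ (2 * k + 1))))|
        ≤ ∑ j ∈ S, (|φ (σ (τ (2 * j))) (f (σ (τ (2 * k))))| +
          |φ (σ (τ (2 * j))) (f (σ (τ (2 * k + 1))))|) := by
          gcongr with j
          rw [map_sub]
          exact abs_sub _ _
      _ ≤ η / 10 + η / 10 := by
          rw [Finset.sum_add_distrib]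
          refine add_le_add (hoff _ _ fun j hj h => hk ?_) (hoff _ _ fun j hj h => by omega)
          obtain rfl : j = k := by omega
          exact hj
      _ = η / 5 := by ring
  · have h1 := (hlimx x).comp (tendsto_atTop_mono (fun k => (by omega : k ≤ 2 * k)) tendsto_id)
    have h2 := (hlimx x).comp
      (tendsto_atTop_mono (fun k => (by omega : k ≤ 2 * k + 1)) tendsto_id)
    rw [← sub_self (f₀ x)]
    exact h1.sub h2

theorem exists_norming_complemented_l1_sequence {X : Type*} [NormedAddCommGroup X]
    [NormedSpace ℝ X] [TopologicalSpace.SeparableSpace X]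
    (ψ : ℕ → (X →L[ℝ] ℝ) →L[ℝ] ℝ) (g : ℕ → X →L[ℝ] ℝ) {C η : ℝ} (hη : 0 < η) (hC : 0 < C)
    (hψ : ∀ h (S : Finset ℕ), ∑ k ∈ S, |ψ k h| ≤ C * ‖h‖) (hg : ∀ k, ‖g k‖ ≤ 2)
    (hdiag : ∀ k, 9 / 10 * η ≤ ψ k (g k))
    (hoff : ∀ k (S : Finset ℕ), k ∉ S → ∑ j ∈ S, |ψ j (g k)| ≤ η / 5)
    (hnull : ∀ x, Tendsto (fun k => g k x) atTop (𝓝 0)) :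
    ∃ xs : ℕ → (X →L[ℝ] ℝ),
      (∃ a : ℝ, 0 < a ∧ ∃ b : ℝ, 0 < b ∧ ∀ (A : Finset ℕ) (lam : ℕ → ℝ),
        a * ∑ i ∈ A, |lam i| ≤ ‖∑ i ∈ A, lam i • xs i‖ ∧
        ‖∑ i ∈ A, lam i • xs i‖ ≤ b * ∑ i ∈ A, |lam i|) ∧
      (∃ θ : ℝ, 0 < θ ∧ ∀ x : X, θ * ‖x‖ ≤ ⨆ i, |xs i x|) ∧
      (∃ P : (X →L[ℝ] ℝ) →L[ℝ] (X →L[ℝ] ℝ),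
        (∀ f, P f ∈ (Submodule.span ℝ (Set.range xs)).topologicalClosure) ∧
        (∀ f ∈ (Submodule.span ℝ (Set.range xs)).topologicalClosure, P f = f)) := by
  obtain ⟨N, hN1, hN⟩ := exists_norming_sequence X
  obtain ⟨M, hM0, hM⟩ : ∃ M : ℝ, 0 < M ∧ C ≤ M * η / 4 :=
    ⟨4 * C / η, by positivity, by field_simp; exact le_rfl⟩
  let xs : ℕ → X →L[ℝ] ℝ := fun m => N m.unpair.1 + M • g m
  have hb : ∀ m, ‖xs m‖ ≤ 1 + M * 2 := fun m => by
    refine (norm_add_le _ _).trans (add_le_add (hN1 _) ?_)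
    rw [norm_smul, Real.norm_of_nonneg hM0.le]
    gcongr
    exact hg m
  have hpos : ∀ j, 0 < ψ j (g j) := fun j => lt_of_lt_of_le (by positivity) (hdiag j)
  set κ := (M * (9 / 10 * η))⁻¹ with hκ
  have hκ0 : 0 < κ := by positivity
  have hinv : ∀ j, |(M * ψ j (g j))⁻¹| ≤ κ := fun j => by
    rw [abs_of_pos (by have := hpos j; positivity)]
    exact inv_anti₀ (by positivity) (by gcongr; exact hdiag j)
  let Ψ : ℕ → (X →L[ℝ] ℝ) →L[ℝ] ℝ := fun j => (M * ψ j (g j))⁻¹ • ψ j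
  have hK : ∀ (f : X →L[ℝ] ℝ) (S : Finset ℕ), ∑ j ∈ S, |Ψ j f| ≤ κ * C * ‖f‖ := by
    intro f S
    calc ∑ j ∈ S, |Ψ j f| ≤ ∑ j ∈ S, κ * |ψ j f| := by
          refine Finset.sum_le_sum fun j _ => ?_
          change |(M * ψ j (g j))⁻¹ * ψ j f| ≤ _
          rw [abs_mul]
          gcongr
          exact hinv j
      _ = κ * ∑ j ∈ S, |ψ j f| := by rw [Finset.mul_sum]
      _ ≤ κ * (C * ‖f‖) := by gcongr; exact hψ f S
      _ = _ := by ring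
  have hΨ : ∀ (k : ℕ) (S : Finset ℕ),
      ∑ j ∈ S, |Ψ j (xs k) - if j = k then 1 else 0| ≤ 1 / 2 := by
    intro k S
    have hterm : ∀ j, |Ψ j (xs k) - if j = k then 1 else 0| ≤
        κ * (|ψ j (N k.unpair.1)| + M * if j = k then 0 else |ψ j (g k)|) := by
      intro j
      have h1 : Ψ j (xs k) - (if j = k then 1 else 0) = (M * ψ j (g j))⁻¹ *
          (ψ j (N k.unpair.1) + M * if j = k then 0 else ψ j (g k)) := by
        change (M * ψ j (g j))⁻¹ * ψ j (N k.unpair.1 + M • g k) - _ = _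
        have := (hpos j).ne'
        rw [map_add, map_smul, smul_eq_mul]
        split_ifs with hjk
        · subst hjk
          field_simp
          ring
        · ring
      rw [h1, abs_mul]
      gcongr
      · exact hinv j
      · refine (abs_add_le _ _).trans ?_
        rw [abs_mul, abs_of_pos hM0]
        split_ifs <;> simp
    have hsplit : ∑ j ∈ S, (if j = k then 0 else |ψ j (g k)|) ≤ η / 5 := by
      refine le_trans (le_of_eq ?_) (hoff k (S.erase k) (Finset.notMem_erase k S))
      rw [← Finset.filter_ne', Finset.sum_filter]
      exact Finset.sum_congr rfl fun j _ => by simp [ite_not]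
    have hNsum : ∑ j ∈ S, |ψ j (N k.unpair.1)| ≤ C :=
      (hψ _ S).trans (mul_le_of_le_one_right hC.le (hN1 _))
    calc _ ≤ ∑ j ∈ S, κ * (|ψ j (N k.unpair.1)| + M * if j = k then 0 else |ψ j (g k)|) :=
          Finset.sum_le_sum fun j _ => hterm j
      _ = κ * (∑ j ∈ S, |ψ j (N k.unpair.1)| +
            M * ∑ j ∈ S, if j = k then 0 else |ψ j (g k)|) := by
          rw [← Finset.mul_sum, Finset.sum_add_distrib, ← Finset.mul_sum]
      _ ≤ κ * (M * η / 4 + M * (η / 5)) := by gcongr; exact hNsum.trans hM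
      _ = 1 / 2 := by rw [hκ]; field_simp; norm_num
  refine ⟨xs, ⟨(2 * (κ * C))⁻¹, by positivity, 1 + M * 2, by positivity, fun A lam => ⟨?_, ?_⟩⟩,
    ⟨1 / 2, by norm_num, fun x => ?_⟩, exists_projection_of_almost_biorthogonal xs Ψ hb hK hΨ⟩
  · have := le_norm_sum_of_almost_biorthogonal xs Ψ hK hΨ A lam
    rw [inv_mul_le_iff₀ (by positivity)]
    linarith
  · rw [Finset.mul_sum]
    refine norm_sum_le_of_le _ fun i _ => ?_
    rw [norm_smul, Real.norm_eq_abs, mul_comm]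
    gcongr
    exact hb i
  · obtain ⟨i, hi⟩ := hN x
    have hbdd : BddAbove (Set.range fun m => |xs m x|) := ⟨(1 + M * 2) * ‖x‖, by
      rintro _ ⟨m, rfl⟩
      exact (xs m).le_of_opNorm_le (hb m) x⟩
    have hlim : Tendsto (fun k => |xs (Nat.pair i k) x|) atTop (𝓝 |N i x|) := by
      have hpair : Tendsto (Nat.pair i) atTop atTop :=
        tendsto_atTop_mono (fun k => Nat.right_le_pair i k) tendsto_id
      have h1 := (((hnull x).comp hpair).const_mul M).const_add (N i x)
      simpa [xs] using h1.abs
    exact hi.trans (le_of_tendsto hlim (Eventually.of_forall fun k => le_ciSup hbdd _))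

/-- If `X` is an infinite dimensional separable `L_∞`-space, then there is a
sequence `(x_i^*)_i` in `X^*` equivalent to the unit vector basis of `ℓ1(ℕ)`, with
`θ ‖x‖ ≤ sup_i |x_i^*(x)|` for some `θ > 0` and all `x ∈ X`, whose closed linear span is
complemented in `X^*`. -/
theorem statement11 {X : Type*} [NormedAddCommGroup X] [NormedSpace ℝ X] [CompleteSpace X]
    [TopologicalSpace.SeparableSpace X] (hinf : ¬FiniteDimensional ℝ X)
    (hX : IsLinftySpace X) :
    ∃ xs : ℕ → (X →L[ℝ] ℝ),
      (∃ a : ℝ, 0 < a ∧ ∃ b : ℝ, 0 < b ∧ ∀ (A : Finset ℕ) (lam : ℕ → ℝ),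
        a * ∑ i ∈ A, |lam i| ≤ ‖∑ i ∈ A, lam i • xs i‖ ∧
        ‖∑ i ∈ A, lam i • xs i‖ ≤ b * ∑ i ∈ A, |lam i|) ∧
      (∃ θ : ℝ, 0 < θ ∧ ∀ x : X, θ * ‖x‖ ≤ ⨆ i, |xs i x|) ∧
      (∃ P : (X →L[ℝ] ℝ) →L[ℝ] (X →L[ℝ] ℝ),
        (∀ f, P f ∈ (Submodule.span ℝ (Set.range xs)).topologicalClosure) ∧
        (∀ f ∈ (Submodule.span ℝ (Set.range xs)).topologicalClosure, P f = f)) := by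
  obtain ⟨C, hC1, hXC⟩ := hX
  have hC0 : 0 < C := by linarith
  choose d t y ht hy hty using fun s : Finset X => hXC.exists_coordinates hC0.le s
  let U : Ultrafilter (Finset X) := Ultrafilter.of atTop
  have htyU : ∀ x, ∀ᶠ s in (U : Filter (Finset X)), x = ∑ i, t s i x • y s i := fun x =>
    Ultrafilter.of_le atTop ((eventually_ge_atTop {x}).mono fun s hs =>
      hty s x (Finset.singleton_subset_iff.1 hs))
  obtain ⟨φ, f, hφ, hf, hφf⟩ := exists_weakly_unconditionally_cauchy U y hC0.le hy (by
    by_contra! h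
    obtain ⟨F, δ, hδ, hF⟩ := h
    exact hinf (finiteDimensional_of_uniform_smallness U t y ht hC0.le hy htyU F hδ hF))
  obtain ⟨ψ, g, hψ, hg, hdiag, hoff, hnull⟩ :=
    exists_weakStar_null_almost_biorthogonal φ f (by norm_num) hφ hf hφf
  exact exists_norming_complemented_l1_sequence ψ g (by norm_num) hC0 hψ hg hdiag hoff hnull
end
end

section
/- Every separable infinite-dimensional L∞-space is isomorphic (as a Banach space) to a Bourgain–Delbaen space; that is, for every separable infinite-dimensional L∞-space X there exist a strictly increasing sequence (Γ_q)_{q=0}^∞ of nonempty finite sets with union Γ and a compatible sequence (i_q)_q of extension operators i_q : ℓ∞(Γ_q) → ℓ∞(Γ) with sup_q ‖i_q‖ < ∞, such that X is isomorphic to the associated Bourgain–Delbaen space 𝔛_{(Γ_q, i_q)_q}. -/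
open scoped ENNReal
open Filter Topology

set_option maxHeartbeats 1000000
set_option synthInstance.maxHeartbeats 400000

noncomputable section

/-- `ℓ∞(Γ)`. -/
abbrev Linf (Γ : Type*) : Type _ := lp (fun _ : Γ => ℝ) ∞

namespace BD

variable {Γ : Type*}

/-- The evaluation map on `ℓ∞(Γ)`, as a linear map. -/
def evalLM (γ : Γ) : Linf Γ →ₗ[ℝ] ℝ where
  toFun f := f γ
  map_add' f g := by simp
  map_smul' c f := by simp

/-- The evaluation functional `e_γ^*` on `ℓ∞(Γ)`. -/
def evalL (γ : Γ) : Linf Γ →L[ℝ] ℝ :=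
  LinearMap.mkContinuous (evalLM γ) 1 fun f => by
    rw [one_mul]
    exact lp.norm_apply_le_norm ENNReal.top_ne_zero f γ

/-- The restriction map `ℓ∞(Γ) → ℓ∞(A)`, as a linear map. -/
def restrLM (A : Finset Γ) : Linf Γ →ₗ[ℝ] (↥A → ℝ) where
  toFun f γ := f γ.1
  map_add' f g := by ext γ; simp
  map_smul' c f := by ext γ; simp

/-- The restriction operator `r_A : ℓ∞(Γ) → ℓ∞(A)` for a finite set `A ⊆ Γ`. -/
def restrCLM (A : Finset Γ) : Linf Γ →L[ℝ] (↥A → ℝ) :=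
  LinearMap.mkContinuous (restrLM A) 1 fun f => by
    rw [one_mul]
    refine (pi_norm_le_iff_of_nonneg (norm_nonneg f)).2 fun γ => ?_
    exact lp.norm_apply_le_norm ENNReal.top_ne_zero f γ.1

/-- The data defining a Bourgain-Delbaen space: a strictly increasing sequence of
nonempty finite subsets of `Γ` covering `Γ`, together with a uniformly bounded compatible
sequence of extension operators. -/
structure System (Γ : Type*) where
  Γs : ℕ → Finset Γ
  strict : StrictMono Γs
  nonempty : ∀ q, (Γs q).Nonempty
  covers : ∀ γ : Γ, ∃ q, γ ∈ Γs q
  i : ∀ q, (↥(Γs q) → ℝ) →L[ℝ] Linf Γ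
  extension : ∀ q (x : ↥(Γs q) → ℝ) (γ : ↥(Γs q)), i q x γ.1 = x γ
  compat : ∀ p q, p < q → ∀ x : ↥(Γs p) → ℝ, i p x = i q (restrCLM (Γs q) (i p x))
  bdd : BddAbove (Set.range fun q => ‖i q‖)

/-- `C = sup_q ‖i_q‖`. -/
def System.C (S : System Γ) : ℝ := ⨆ q, ‖S.i q‖

/-- `Δ_0 = Γ_0`, `Δ_q = Γ_q \ Γ_{q-1}`. -/
def System.Δ (S : System Γ) : ℕ → Finset Γ := fun q =>
  letI := Classical.decEq Γ
  match q with
  | 0 => S.Γs 0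
  | q + 1 => S.Γs (q + 1) \ S.Γs q

/-- The unique `q` with `γ ∈ Δ_q`. -/
def System.rk (S : System Γ) (γ : Γ) : ℕ :=
  letI := Classical.decEq Γ
  Nat.find (S.covers γ)

/-- The vector `d_γ = i_q (e_γ)` for `γ ∈ Δ_q`. -/
def System.dvec (S : System Γ) (γ : Γ) : Linf Γ :=
  letI := Classical.decEq Γ
  S.i (S.rk γ) fun δ => if (δ : Γ) = γ then 1 else 0

/-- `M_q = span {d_γ : γ ∈ Δ_q}`. -/
def System.M (S : System Γ) (q : ℕ) : Submodule ℝ (Linf Γ) :=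
  Submodule.span ℝ (S.dvec '' (S.Δ q : Set Γ))

/-- The Bourgain-Delbaen space: the closed linear span of the `d_γ`'s in `ℓ∞(Γ)`. -/
def System.space (S : System Γ) : Submodule ℝ (Linf Γ) :=
  (Submodule.span ℝ (Set.range S.dvec)).topologicalClosure


section ShortcutInstances

noncomputable instance (priority := 10000) instLinfNACG (Γ : Type*) :
    NormedAddCommGroup (Linf Γ) := inferInstance

noncomputable instance (priority := 10000) instLinfNS (Γ : Type*) :
    NormedSpace ℝ (Linf Γ) := inferInstance

noncomputable instance (priority := 10000) instSpaceNACG (S : System Γ) :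
    NormedAddCommGroup ↥S.space := inferInstance

noncomputable instance (priority := 10000) instSpaceNS (S : System Γ) :
    NormedSpace ℝ ↥S.space := inferInstance

noncomputable instance (priority := 10000) instDualNACG (S : System Γ) :
    NormedAddCommGroup (↥S.space →L[ℝ] ℝ) := inferInstance

noncomputable instance (priority := 10000) instDualNS (S : System Γ) :
    NormedSpace ℝ (↥S.space →L[ℝ] ℝ) := inferInstance

end ShortcutInstances

lemma dvec_mem (S : System Γ) (γ : Γ) : S.dvec γ ∈ S.space :=
  Submodule.le_topologicalClosure _ (Submodule.subset_span ⟨γ, rfl⟩)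

end BD

namespace LinftyBD

section Finite

/-- A linear functional on `ℓ∞(ι)` of norm at most `C` has `ℓ₁`-norm at most `C`. -/
lemma sum_abs_single_le {ι : Type*} [Fintype ι] [DecidableEq ι] (L : (ι → ℝ) →ₗ[ℝ] ℝ) {C : ℝ}
    (h : ∀ v, |L v| ≤ C * ‖v‖) (hC : 0 ≤ C) : ∑ i, |L (Pi.single i 1)| ≤ C := by
  have key : L (fun i => SignType.sign (L (Pi.single i 1)) : ι → ℝ)
      = ∑ i, |L (Pi.single i 1)| := by
    rw [LinearMap.pi_apply_eq_sum_univ L]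
    refine Finset.sum_congr rfl fun i _ => ?_
    rw [smul_eq_mul, show (fun j => if i = j then (1 : ℝ) else 0) = Pi.single i 1 by
      ext j; simp [Pi.single_apply, eq_comm]]
    exact sign_mul_self _
  have hn : ‖(fun i => SignType.sign (L (Pi.single i 1)) : ι → ℝ)‖ ≤ 1 := by
    refine (pi_norm_le_iff_of_nonneg zero_le_one).2 fun i => ?_
    rcases SignType.sign (L (Pi.single i 1)) with _ | _ | _ <;> simp
  calc ∑ i, |L (Pi.single i 1)| = L _ := key.symm
    _ ≤ |L _| := le_abs_self _
    _ ≤ C * _ := h _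
    _ ≤ C := by nlinarith

lemma linear_apply_eq_sum {ι M : Type*} [Fintype ι] [DecidableEq ι] [AddCommGroup M] [Module ℝ M]
    (L : (ι → ℝ) →ₗ[ℝ] M) (v : ι → ℝ) : L v = ∑ i, v i • L (Pi.single i 1) := by
  rw [LinearMap.pi_apply_eq_sum_univ L]
  refine Finset.sum_congr rfl fun i _ => ?_
  congr 2
  ext j; simp [Pi.single_apply, eq_comm]

/-- An operator on `ℓ∞(ι)`, `ι` finite, that is bounded below is invertible. -/
lemma exists_right_inverse {ι : Type*} [Fintype ι] (M : (ι → ℝ) →ₗ[ℝ] (ι → ℝ)) {c : ℝ}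
    (hc : 0 < c) (h : ∀ v, c * ‖v‖ ≤ ‖M v‖) :
    ∃ M' : (ι → ℝ) →ₗ[ℝ] (ι → ℝ), (∀ v, M (M' v) = v) ∧ ∀ v, ‖M' v‖ ≤ c⁻¹ * ‖v‖ := by
  have hinj : Function.Injective M := by
    rw [← LinearMap.ker_eq_bot, LinearMap.ker_eq_bot']
    intro v hv
    have := h v
    rw [hv, norm_zero] at this
    exact norm_le_zero_iff.1 (by nlinarith [norm_nonneg v])
  let e := LinearEquiv.ofInjectiveEndo M hinj
  have he : ∀ v, M (e.symm v) = v := fun v => e.apply_symm_apply v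
  refine ⟨e.symm, he, fun v => ?_⟩
  have := h (e.symm v)
  rw [he] at this
  rw [inv_mul_eq_div, le_div_iff₀ hc, mul_comm]
  exact this

lemma exists_ne_zero_map_eq_zero {W : Type*} [AddCommGroup W] [Module ℝ W] [FiniteDimensional ℝ W]
    {m : ℕ} (hm : Module.finrank ℝ W ≤ m) (T : (Fin (m + 1) → ℝ) →ₗ[ℝ] W) :
    ∃ a, a ≠ 0 ∧ T a = 0 := by
  have : LinearMap.ker T ≠ ⊥ := LinearMap.ker_ne_bot_of_finrank_lt (by simp; omega)
  obtain ⟨a, ha, ha0⟩ := Submodule.exists_mem_ne_zero_of_ne_bot this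
  exact ⟨a, ha0, ha⟩

lemma exists_coord_eq_one_map_eq_zero {W : Type*} [AddCommGroup W] [Module ℝ W]
    [FiniteDimensional ℝ W] {m : ℕ} (hm : Module.finrank ℝ W ≤ m)
    (T : (Fin (m + 1) → ℝ) →ₗ[ℝ] W) :
    ∃ (a : Fin (m + 1) → ℝ) (t : Fin (m + 1)), a t = 1 ∧ (∀ r, |a r| ≤ 1) ∧ T a = 0 := by
  obtain ⟨a, ha, hT⟩ := exists_ne_zero_map_eq_zero hm T
  obtain ⟨t, ht⟩ := Finite.exists_max fun r => |a r|
  have hat : a t ≠ 0 := by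
    intro h0
    apply ha
    ext r
    have := ht r
    rw [h0, abs_zero] at this
    exact abs_nonpos_iff.1 this
  refine ⟨(a t)⁻¹ • a, t, by simp [hat], fun r => ?_, by simp [hT]⟩
  rw [Pi.smul_apply, smul_eq_mul, abs_mul, abs_inv, inv_mul_le_iff₀ (abs_pos.2 hat), mul_one]
  exact ht r

lemma exists_sum_abs_eq_one_map_eq_zero {W : Type*} [AddCommGroup W] [Module ℝ W]
    [FiniteDimensional ℝ W] {m : ℕ} (hm : Module.finrank ℝ W ≤ m)
    (T : (Fin (m + 1) → ℝ) →ₗ[ℝ] W) :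
    ∃ a : Fin (m + 1) → ℝ, ∑ r, |a r| = 1 ∧ T a = 0 := by
  obtain ⟨a, ha, hT⟩ := exists_ne_zero_map_eq_zero hm T
  have hs : 0 < ∑ r, |a r| := by
    obtain ⟨r, hr⟩ := Function.ne_iff.1 ha
    exact Finset.sum_pos' (fun _ _ => abs_nonneg _) ⟨r, Finset.mem_univ r, abs_pos.2 hr⟩
  refine ⟨(∑ r, |a r|)⁻¹ • a, ?_, by simp [hT]⟩
  simp only [Pi.smul_apply, smul_eq_mul, abs_mul, abs_inv, abs_of_pos hs]
  rw [← Finset.mul_sum, inv_mul_cancel₀ hs.ne']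

end Finite

section Rosenthal

/-- Rosenthal's lemma for matrices with nonnegative entries and bounded row sums. -/
lemma rosenthal {ε : ℝ} (hε : 0 < ε) (m : ℕ) (a : ℕ → ℕ → ℝ)
    (hsum : ∀ j (s : Finset ℕ), ∑ k ∈ s, a j k ≤ m * ε) :
    ∃ φ : ℕ → ℕ, Function.Injective φ ∧
      ∀ j (s : Finset ℕ), j ∉ s → ∑ k ∈ s, a (φ j) (φ k) ≤ ε := by
  induction m generalizing a with
  | zero =>
    refine ⟨id, Function.injective_id, fun j s _ => ?_⟩
    have := hsum j s
    simp only [Nat.cast_zero, zero_mul] at this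
    exact this.trans hε.le
  | succ m ih =>
    by_cases hp : ∃ p, ∀ l (s : Finset ℕ), l ∉ s →
        ∑ k ∈ s, a (Nat.pair p l) (Nat.pair p k) ≤ ε
    · obtain ⟨p, hp⟩ := hp
      exact ⟨Nat.pair p, fun x y h => (Nat.pair_eq_pair.1 h).2, hp⟩
    · push Not at hp
      choose l s hl hls using hp
      have hinj : Function.Injective fun p => Nat.pair p (l p) :=
        fun x y h => (Nat.pair_eq_pair.1 h).1
      obtain ⟨φ, hφ, h⟩ := ih (fun p r => a (Nat.pair p (l p)) (Nat.pair r (l r))) fun p t => by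
        classical
        have hdisj : Disjoint (t.image fun r => Nat.pair r (l r)) ((s p).image (Nat.pair p)) := by
          rw [Finset.disjoint_left]
          intro x hx hx'
          obtain ⟨r, -, rfl⟩ := Finset.mem_image.1 hx
          obtain ⟨k, hk, hkr⟩ := Finset.mem_image.1 hx'
          obtain ⟨rfl, rfl⟩ := Nat.pair_eq_pair.1 hkr
          exact hl _ hk
        have := hsum (Nat.pair p (l p))
          ((t.image fun r => Nat.pair r (l r)) ∪ (s p).image (Nat.pair p))
        rw [Finset.sum_union hdisj, Finset.sum_image fun x _ y _ h => hinj h,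
          Finset.sum_image fun x _ y _ h => (Nat.pair_eq_pair.1 h).2] at this
        have := hls p
        push_cast at *
        linarith
      exact ⟨fun j => Nat.pair (φ j) (l (φ j)), hinj.comp hφ, h⟩

end Rosenthal

variable {X : Type*} [NormedAddCommGroup X] [NormedSpace ℝ X]

section LocalStructure

/-- A contraction from a subspace of `X` to `ℓ∞(ι)` extends to a contraction on `X`. -/
lemma exists_extension_pi {ι : Type*} [Fintype ι] (G : Submodule ℝ X) (T : G →L[ℝ] (ι → ℝ))
    (hT : ∀ x, ‖T x‖ ≤ ‖x‖) :
    ∃ α : X →L[ℝ] (ι → ℝ), (∀ x, ‖α x‖ ≤ ‖x‖) ∧ ∀ x : G, α x = T x := by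
  have h : ∀ i, ∃ g : X →L[ℝ] ℝ, (∀ x : G, g x = T x i) ∧ ‖g‖ ≤ 1 := fun i => by
    obtain ⟨g, hg, hn⟩ := exists_extension_norm_eq G ((ContinuousLinearMap.proj i).comp T)
    refine ⟨g, hg, hn ▸ ContinuousLinearMap.opNorm_le_bound _ zero_le_one fun x => ?_⟩
    rw [one_mul]
    exact (norm_le_pi_norm (T x) i).trans (hT x)
  choose g hg hn using h
  refine ⟨ContinuousLinearMap.pi g, fun x => ?_, fun x => funext fun i => hg i x⟩
  refine (pi_norm_le_iff_of_nonneg (norm_nonneg x)).2 fun i => ?_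
  simpa using (g i).le_of_opNorm_le (hn i) x

/-- Every finite-dimensional subspace lies in a subspace that is `lam`-isomorphic to some
`ℓ∞^N` through a contraction defined on all of `X`. -/
def LocallyLinfty (X : Type*) [NormedAddCommGroup X] [NormedSpace ℝ X] (lam : ℝ) : Prop :=
  ∀ F : Submodule ℝ X, FiniteDimensional ℝ F →
    ∃ (N : ℕ) (α : X →L[ℝ] (Fin N → ℝ)) (β : (Fin N → ℝ) →ₗ[ℝ] X),
      (∀ x, ‖α x‖ ≤ ‖x‖) ∧ (∀ v, ‖β v‖ ≤ lam * ‖v‖) ∧ (∀ v, α (β v) = v) ∧ F ≤ LinearMap.range β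

lemma locallyLinfty_of_isLinftyCSpace [Nontrivial X] {C : ℝ} (hX : IsLinftyCSpace X C) :
    LocallyLinfty X C := by
  intro F hF
  obtain ⟨x₀, hx₀⟩ := exists_ne (0 : X)
  obtain ⟨G, hFG, hG, T, hT⟩ := hX (F ⊔ Submodule.span ℝ {x₀}) inferInstance
  have hx₀G : x₀ ∈ G := hFG (Submodule.mem_sup_right (Submodule.mem_span_singleton_self x₀))
  set t := ‖(T : G →L[ℝ] (Fin (Module.finrank ℝ G) → ℝ))‖ with ht
  have hle : ∀ x, ‖T x‖ ≤ t * ‖x‖ :=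
    (T : G →L[ℝ] (Fin (Module.finrank ℝ G) → ℝ)).le_opNorm
  have ht0 : 0 < t := by
    have h0 : 0 < ‖T ⟨x₀, hx₀G⟩‖ := by
      rw [norm_pos_iff, Ne, T.map_eq_zero_iff]
      simpa using hx₀
    exact pos_of_mul_pos_left (h0.trans_le (hle _)) (norm_nonneg _)
  obtain ⟨α, hα, hαT⟩ := exists_extension_pi G
    (t⁻¹ • (T : G →L[ℝ] (Fin (Module.finrank ℝ G) → ℝ))) fun x => by
      change ‖t⁻¹ • T x‖ ≤ ‖x‖
      rw [norm_smul, norm_inv, Real.norm_of_nonneg ht0.le,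
        inv_mul_le_iff₀ ht0]
      exact hle x
  refine ⟨_, α, G.subtype ∘ₗ (t • T.symm.toLinearEquiv.toLinearMap), hα, fun v => ?_, fun v => ?_,
    fun x hx => ?_⟩
  · have h1 : ‖T.symm v‖ ≤ _ := ContinuousLinearMap.le_opNorm
      (T.symm : (Fin (Module.finrank ℝ G) → ℝ) →L[ℝ] G) v
    calc ‖t • (T.symm v : X)‖ = t * ‖T.symm v‖ := by
          rw [norm_smul, Real.norm_of_nonneg ht0.le]; rfl
      _ ≤ t * (_ * ‖v‖) := by gcongr
      _ ≤ C * ‖v‖ := by rw [← mul_assoc]; gcongr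
  · have := hαT (t • T.symm v)
    simpa [ht0.ne'] using this
  · refine ⟨t⁻¹ • T ⟨x, hFG (Submodule.mem_sup_left hx)⟩, ?_⟩
    simp [ht0.ne']

/-- Spaces `ℓ∞(ι)` of every finite dimension sit uniformly complemented in `X`. -/
lemma LocallyLinfty.exists_embedding {lam : ℝ} (hX : LocallyLinfty X lam) (hlam : 0 ≤ lam)
    (hinf : ¬FiniteDimensional ℝ X) (n : ℕ) :
    ∃ (V : Fin n → X →L[ℝ] ℝ) (u : (Fin n → ℝ) →ₗ[ℝ] X),
      (∀ i, ‖V i‖ ≤ 1) ∧ (∀ v, ‖u v‖ ≤ lam * ‖v‖) ∧ ∀ v i, V i (u v) = v i := by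
  obtain ⟨f, hf⟩ := exists_linearIndependent_of_le_rank (R := ℝ) (M := X) (n := n)
    (by
      have := Module.rank_lt_aleph0_iff (R := ℝ) (M := X)
      have h2 := not_lt.1 (this.not.2 hinf)
      exact (Cardinal.natCast_lt_aleph0 (n := n)).le.trans h2)
  obtain ⟨N, α, β, hα, hβ, hαβ, hF⟩ := hX (Submodule.span ℝ (Set.range f))
    (FiniteDimensional.span_of_finite ℝ (Set.finite_range f))
  have hnN : n ≤ N := by
    have h1 := finrank_span_eq_card hf
    have h2 := Submodule.finrank_mono hF
    have h3 := LinearMap.finrank_range_le β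
    simp at h1 h3
    omega
  refine ⟨fun i => (ContinuousLinearMap.proj (Fin.castLE hnN i)).comp α,
    β ∘ₗ Function.ExtendByZero.linearMap ℝ (Fin.castLE hnN), fun i => ?_, fun v => ?_,
    fun v i => ?_⟩
  · refine ContinuousLinearMap.opNorm_le_bound _ zero_le_one fun x => ?_
    rw [one_mul]
    exact (norm_le_pi_norm (α x) _).trans (hα x)
  · refine (hβ _).trans (mul_le_mul_of_nonneg_left ?_ hlam)
    refine (pi_norm_le_iff_of_nonneg (norm_nonneg v)).2 fun t => ?_
    simp only [Function.ExtendByZero.linearMap_apply]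
    by_cases ht : ∃ i, Fin.castLE hnN i = t
    · obtain ⟨i, rfl⟩ := ht
      rw [(Fin.castLE_injective hnN).extend_apply]
      exact norm_le_pi_norm v i
    · rw [Function.extend_apply' _ _ _ ht]
      simp
  · simp [hαβ, (Fin.castLE_injective hnN).extend_apply]

end LocalStructure

section Biorthogonal

/-- `Y` is a sequence of contractive functionals all of whose finite initial segments have
biorthogonal vectors that are `K`-dominated by the unit vector basis of `ℓ∞^n`. -/
def IsLinftyDual (K : ℝ) (Y : ℕ → X →L[ℝ] ℝ) : Prop :=
  (∀ k, ‖Y k‖ ≤ 1) ∧ ∀ n, ∃ y : (Fin n → ℝ) →ₗ[ℝ] X,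
    (∀ v, ‖y v‖ ≤ K * ‖v‖) ∧ ∀ v (i : Fin n), Y i (y v) = v i

/-- The functionals from the `n`-th on can be replaced by blocks that vanish on a given
finite-dimensional subspace. -/
lemma IsLinftyDual.exists_vanishing_tail {K : ℝ} {Y : ℕ → X →L[ℝ] ℝ} (hY : IsLinftyDual K Y)
    (hK : 0 ≤ K) (n : ℕ) (F : Submodule ℝ X) [FiniteDimensional ℝ F] :
    ∃ Y' : ℕ → X →L[ℝ] ℝ, IsLinftyDual K Y' ∧ (∀ k < n, Y' k = Y k) ∧
      ∀ k, n ≤ k → ∀ x ∈ F, Y' k x = 0 := by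
  set d := Module.finrank ℝ F
  let idx : ℕ → Fin (d + 1) → ℕ := fun k r => n + ((k - n) * (d + 1) + r)
  have hc : ∀ k, ∃ c : Fin (d + 1) → ℝ, ∑ r, |c r| = 1 ∧
      ∀ x ∈ F, ∑ r, c r * Y (idx k r) x = 0 := fun k => by
    obtain ⟨c, hc, h0⟩ := exists_sum_abs_eq_one_map_eq_zero (W := Module.Dual ℝ F)
      Subspace.dual_finrank_eq.le (Fintype.linearCombination ℝ fun r =>
        (Y (idx k r)).toLinearMap.domRestrict F)
    refine ⟨c, hc, fun x hx => ?_⟩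
    have := LinearMap.congr_fun h0 ⟨x, hx⟩
    simpa [Fintype.linearCombination_apply] using this
  choose c hc1 hcF using hc
  let π : ℕ → ℕ := fun j => if j < n then j else n + (j - n) / (d + 1)
  let s : ℕ → ℝ := fun j => if j < n then 1 else
    SignType.sign (c (π j) ⟨(j - n) % (d + 1), Nat.mod_lt _ d.succ_pos⟩)
  have hs : ∀ j, |s j| ≤ 1 := fun j => by
    simp only [s]
    split_ifs
    · simp
    · rcases SignType.sign (c (π j) ⟨(j - n) % (d + 1), Nat.mod_lt _ d.succ_pos⟩)
        with _ | _ | _ <;> simp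
  have hπidx : ∀ k, n ≤ k → ∀ r, π (idx k r) = k := fun k hk r => by
    simp only [π, idx]
    rw [if_neg (by omega), Nat.add_sub_cancel_left, mul_comm, Nat.mul_add_div d.succ_pos,
      Nat.div_eq_of_lt r.2]
    omega
  have hsidx : ∀ k, n ≤ k → ∀ r, s (idx k r) = SignType.sign (c k r) := fun k hk r => by
    simp only [s]
    rw [hπidx k hk r]
    simp only [idx]
    rw [if_neg (by omega)]
    congr 3
    ext
    simp only [Nat.add_sub_cancel_left]
    rw [mul_comm, Nat.mul_add_mod, Nat.mod_eq_of_lt r.2]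
  refine ⟨fun k => if k < n then Y k else ∑ r, c k r • Y (idx k r), ⟨fun k => ?_, fun m => ?_⟩,
    fun k hk => if_pos hk, fun k hk x hx => ?_⟩
  · dsimp only
    split_ifs
    · exact hY.1 k
    · refine (norm_sum_le _ _).trans ?_
      rw [← hc1 k]
      refine Finset.sum_le_sum fun r _ => ?_
      rw [norm_smul, Real.norm_eq_abs]
      exact mul_le_of_le_one_right (abs_nonneg _) (hY.1 _)
  · obtain ⟨y, hy, hYy⟩ := hY.2 (n + m * (d + 1))
    let L : (Fin m → ℝ) →ₗ[ℝ] (Fin (n + m * (d + 1)) → ℝ) :=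
      { toFun := fun v j => if h : π j < m then s j * v ⟨π j, h⟩ else 0
        map_add' := fun v w => by
          ext j
          by_cases h : π j < m <;> simp [h, mul_add]
        map_smul' := fun a v => by
          ext j
          by_cases h : π j < m <;> simp [h, mul_left_comm] }
    refine ⟨y ∘ₗ L, fun v => (hy _).trans (mul_le_mul_of_nonneg_left ?_ hK), fun v i => ?_⟩
    · refine (pi_norm_le_iff_of_nonneg (norm_nonneg v)).2 fun j => ?_
      by_cases h : π j < m
      · simp only [L, LinearMap.coe_mk, AddHom.coe_mk, h, dif_pos, norm_mul, Real.norm_eq_abs]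
        exact (mul_le_of_le_one_left (abs_nonneg _) (hs j)).trans (norm_le_pi_norm v _)
      · simp [L, h]
    · dsimp only
      have him := i.2
      have hLv : ∀ j (hj : j < n + m * (d + 1)), π j = i → L v ⟨j, hj⟩ = s j * v i := by
        intro j hj hji
        have h : π j < m := hji ▸ him
        simp only [L, LinearMap.coe_mk, AddHom.coe_mk, h, dif_pos]
        congr 2
        exact Fin.ext hji
      split_ifs with hin
      · have h1 := hYy (L v) ⟨i, by omega⟩
        rw [hLv i _ (by simp [π, hin])] at h1
        simpa [s, hin] using h1
      · push Not at hin
        have hlt : ∀ r, idx i r < n + m * (d + 1) := fun r => by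
          have : (i - n + 1) * (d + 1) ≤ m * (d + 1) := Nat.mul_le_mul_right _ (by omega)
          have h2 := r.2
          simp only [idx]
          nlinarith
        have hterm : ∀ r, Y (idx i r) (y (L v)) = SignType.sign (c i r) * v i := fun r => by
          have h1 := hYy (L v) ⟨idx i r, hlt r⟩
          rw [hLv _ _ (hπidx i hin r), hsidx i hin r] at h1
          exact h1
        simp only [sum_apply, LinearMap.comp_apply]
        calc ∑ r, (c i r • Y (idx i r)) (y (L v)) = ∑ r, |c i r| * v i :=
              Finset.sum_congr rfl fun r _ => by
                change c i r * Y (idx i r) (y (L v)) = _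
                rw [hterm, ← mul_assoc, self_mul_sign]
          _ = v i := by rw [← Finset.sum_mul, hc1, one_mul]
  · dsimp only
    rw [if_neg (by omega)]
    simpa [sum_apply] using hcF k x hx

/-- Complemented copies of `ℓ∞^N` on which a given finite-rank map vanishes, such that the
projection vanishes on a given finite-dimensional subspace. -/
lemma IsLinftyDual.exists_embedding {K : ℝ} {Y : ℕ → X →L[ℝ] ℝ} (hY : IsLinftyDual K Y)
    (hK : 0 ≤ K) {W : Type*} [AddCommGroup W] [Module ℝ W] [FiniteDimensional ℝ W]
    (Φ : X →ₗ[ℝ] W) (F : Submodule ℝ X) [FiniteDimensional ℝ F] (N : ℕ) :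
    ∃ (R : X →L[ℝ] (Fin N → ℝ)) (J : (Fin N → ℝ) →ₗ[ℝ] X),
      (∀ x, ‖R x‖ ≤ ‖x‖) ∧ (∀ v, ‖J v‖ ≤ K * ‖v‖) ∧ (∀ v, R (J v) = v) ∧
      (∀ v, Φ (J v) = 0) ∧ ∀ x ∈ F, R x = 0 := by
  obtain ⟨Y', hY', -, hF⟩ := hY.exists_vanishing_tail hK 0 F
  set m := Module.finrank ℝ W with hm
  obtain ⟨y, hy, hYy⟩ := hY'.2 (N * (m + 1))
  let e : Fin N × Fin (m + 1) ≃ Fin (N * (m + 1)) := finProdFinEquiv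
  let L : Fin N → (Fin (m + 1) → ℝ) →ₗ[ℝ] (Fin (N * (m + 1)) → ℝ) := fun i =>
    { toFun := fun a j => if (e.symm j).1 = i then a (e.symm j).2 else 0
      map_add' := fun v w => by
        ext j
        by_cases h : (e.symm j).1 = i <;> simp [h]
      map_smul' := fun a v => by
        ext j
        by_cases h : (e.symm j).1 = i <;> simp [h] }
  have h := fun i => exists_coord_eq_one_map_eq_zero hm.ge (Φ ∘ₗ y ∘ₗ L i)
  choose a t hat ha hΦ using h
  let S : (Fin N → ℝ) →ₗ[ℝ] (Fin (N * (m + 1)) → ℝ) :=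
    Fintype.linearCombination ℝ fun i => L i (a i)
  have hS : ∀ v i r, S v (e (i, r)) = v i * a i r := fun v i r => by
    simp [S, L, Fintype.linearCombination_apply]
  refine ⟨ContinuousLinearMap.pi fun i => Y' (e (i, t i)), y ∘ₗ S, fun x => ?_,
    fun v => (hy _).trans (mul_le_mul_of_nonneg_left ?_ hK), fun v => ?_, fun v => ?_,
    fun x hx => ?_⟩
  · refine (pi_norm_le_iff_of_nonneg (norm_nonneg x)).2 fun i => ?_
    simpa using (Y' (e (i, t i))).le_of_opNorm_le (hY'.1 _) x
  · refine (pi_norm_le_iff_of_nonneg (norm_nonneg v)).2 fun j => ?_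
    obtain ⟨⟨i, r⟩, rfl⟩ := e.surjective j
    rw [hS, norm_mul]
    exact (mul_le_of_le_one_right (norm_nonneg _) (ha i r)).trans (norm_le_pi_norm v i)
  · ext i
    simp [hYy, hS, hat]
  · have : ∀ i, Φ (y (L i (a i))) = 0 := hΦ
    simp [S, Fintype.linearCombination_apply, this]
  · ext i
    exact hF _ (Nat.zero_le _) x hx

/-- Enlarging a complemented copy of `ℓ∞^n` so that it contains a given finite-dimensional
subspace, with control of the constants. -/
lemma exists_complement {lam K κ : ℝ} (hX : LocallyLinfty X lam) (hK : 0 ≤ K)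
    (hκ : 0 ≤ κ) {Y : ℕ → X →L[ℝ] ℝ} (hY : IsLinftyDual K Y) {n : ℕ}
    (f : X →L[ℝ] (Fin n → ℝ)) (w : (Fin n → ℝ) →ₗ[ℝ] X) (hf : ∀ x, ‖f x‖ ≤ 2 * ‖x‖)
    (hw : ∀ v, ‖w v‖ ≤ κ * ‖v‖) (hfw : ∀ v, f (w v) = v)
    (H : Submodule ℝ X) [FiniteDimensional ℝ H] :
    ∃ (N : ℕ) (B : (Fin N → ℝ) →ₗ[ℝ] X) (g : X →L[ℝ] (Fin N → ℝ)),
      (∀ v, f (B v) = 0) ∧ (∀ v, g (B v) = v) ∧ (∀ v, g (w v) = 0) ∧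
      (∀ x, ‖g x‖ ≤ (2 + 2 * κ) * ‖x‖) ∧
      (∀ v, ‖B v‖ ≤ ((1 + 2 * κ) * lam + K * (1 + (1 + 2 * κ) * ((1 + 2 * κ) * lam))) * ‖v‖) ∧
      H ≤ LinearMap.range w ⊔ LinearMap.range B := by
  let Q : X →ₗ[ℝ] X := LinearMap.id - w ∘ₗ f.toLinearMap
  have hQ : ∀ x, Q x = x - w (f x) := fun x => rfl
  have hfQ : ∀ x, f (Q x) = 0 := fun x => by rw [hQ, map_sub, hfw, sub_self]
  have hQQ : ∀ x, Q (Q x) = Q x := fun x => by rw [hQ (Q x), hfQ, map_zero, sub_zero]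
  have hQw : ∀ v, Q (w v) = 0 := fun v => by rw [hQ, hfw, sub_self]
  have hQn : ∀ x, ‖Q x‖ ≤ (1 + 2 * κ) * ‖x‖ := fun x => by
    have h1 := hw (f x)
    have h2 := mul_le_mul_of_nonneg_left (hf x) hκ
    calc ‖Q x‖ ≤ ‖x‖ + ‖w (f x)‖ := norm_sub_le _ _
      _ ≤ (1 + 2 * κ) * ‖x‖ := by linarith
  obtain ⟨N, α, β, hα, hβ, hαβ, hrange⟩ := hX (H.map Q) inferInstance
  obtain ⟨R, J, hR, hJ, hRJ, hΦ, hRF⟩ := hY.exists_embedding hK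
    (f.toLinearMap.prod α.toLinearMap) (LinearMap.range w ⊔ LinearMap.range β) N
  have hfJ : ∀ v, f (J v) = 0 := fun v => congrArg Prod.fst (hΦ v)
  have hαJ : ∀ v, α (J v) = 0 := fun v => congrArg Prod.snd (hΦ v)
  have hRw : ∀ v, R (w v) = 0 := fun v => hRF _ (Submodule.mem_sup_left ⟨v, rfl⟩)
  have hRβ : ∀ v, R (β v) = 0 := fun v => hRF _ (Submodule.mem_sup_right ⟨v, rfl⟩)
  have hQJ : ∀ v, Q (J v) = J v := fun v => by rw [hQ, hfJ, map_zero, sub_zero]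
  have hRQβ : ∀ v, R (Q (β v)) = 0 := fun v => by rw [hQ, map_sub, hRβ, hRw, sub_zero]
  let A : X →L[ℝ] (Fin N → ℝ) := α - (α.comp (LinearMap.toContinuousLinearMap w)).comp f
  have hA : ∀ x, A x = α (Q x) := fun x => by rw [hQ, map_sub]; rfl
  let B : (Fin N → ℝ) →ₗ[ℝ] X := Q ∘ₗ β + J ∘ₗ (LinearMap.id - A.toLinearMap ∘ₗ Q ∘ₗ β)
  have hB : ∀ v, B v = Q (β v) + J (v - A (Q (β v))) := fun v => rfl
  refine ⟨N, B, A + R, fun v => ?_, fun v => ?_, fun v => ?_, fun x => ?_, fun v => ?_,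
    fun x hx => ?_⟩
  · rw [hB, map_add, hfQ, hfJ, add_zero]
  · change A (B v) + R (B v) = v
    rw [hB, map_add, map_add, hRQβ, hRJ, hA (J _), hQJ, hαJ]
    abel
  · change A (w v) + R (w v) = 0
    rw [hA, hQw, hRw, map_zero, add_zero]
  · change ‖A x + R x‖ ≤ _
    have h1 := norm_add_le (A x) (R x)
    have h2 := (hα (Q x)).trans (hQn x)
    rw [hA x] at *
    linarith [hR x]
  · rw [hB]
    have h1 : ‖Q (β v)‖ ≤ (1 + 2 * κ) * lam * ‖v‖ := by
      rw [mul_assoc]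
      exact (hQn _).trans (mul_le_mul_of_nonneg_left (hβ v) (by positivity))
    have h2 : ‖A (Q (β v))‖ ≤ (1 + 2 * κ) * ((1 + 2 * κ) * lam) * ‖v‖ := by
      rw [hA, mul_assoc]
      exact ((hα _).trans (hQn _)).trans (mul_le_mul_of_nonneg_left h1 (by positivity))
    have h3 := norm_sub_le v (A (Q (β v)))
    have h4 := (hJ (v - A (Q (β v)))).trans (mul_le_mul_of_nonneg_left (h3.trans
      (add_le_add_right h2 _)) hK)
    have h5 := norm_add_le (Q (β v)) (J (v - A (Q (β v))))
    linarith
  · obtain ⟨v, hv⟩ := hrange (Submodule.mem_map_of_mem hx)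
    have h1 : B v = Q x := by
      have : A (Q (β v)) = v := by rw [hA, hQQ, hv, hQQ, ← hv, hαβ]
      rw [hB, this, sub_self, map_zero, add_zero, hv, hQQ]
    have h2 : x = w (f x) + B v := by rw [h1, hQ]; abel
    rw [h2]
    exact Submodule.add_mem_sup ⟨_, rfl⟩ ⟨_, rfl⟩

/-- The constant bounding the extension operators in terms of the local data. -/
def stageConst (lam K : ℝ) : ℝ :=
  2 * K + ((1 + 2 * (2 * K)) * lam + K * (1 + (1 + 2 * (2 * K)) * ((1 + 2 * (2 * K)) * lam))) *
    ((2 + 2 * (2 * K)) * (2 * K))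

/-- A finite stage of the construction: functionals `f 0, …, f (n - 1)`, close to the
functionals `Y k`, with biorthogonal vectors dominated by the unit vector basis of `ℓ∞^n`. -/
structure Stage (X : Type*) [NormedAddCommGroup X] [NormedSpace ℝ X] (lam K : ℝ) where
  n : ℕ
  Y : ℕ → X →L[ℝ] ℝ
  f : ℕ → X →L[ℝ] ℝ
  u : (Fin n → ℝ) →ₗ[ℝ] X
  isLinftyDual : IsLinftyDual K Y
  near : ∀ k < n, ‖f k - Y k‖ ≤ (2 * K)⁻¹
  bound : ∀ v, ‖u v‖ ≤ stageConst lam K * ‖v‖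
  apply_u : ∀ v (i : Fin n), f i (u v) = v i

lemma Stage.norm_f_le {lam K : ℝ} (hK : 1 ≤ K) (s : Stage X lam K) {k : ℕ} (hk : k < s.n) :
    ‖s.f k‖ ≤ 2 := by
  have h1 := s.near k hk
  have h2 := s.isLinftyDual.1 k
  have h3 : (2 * K)⁻¹ ≤ 1 := inv_le_one_of_one_le₀ (by linarith)
  have h4 := norm_add_le (s.f k - s.Y k) (s.Y k)
  rw [sub_add_cancel] at h4
  linarith

lemma Stage.exists_dual {lam K : ℝ} (hK : 1 ≤ K) (s : Stage X lam K) :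
    ∃ w : (Fin s.n → ℝ) →ₗ[ℝ] X, (∀ v, ‖w v‖ ≤ 2 * K * ‖v‖) ∧
      ∀ v (i : Fin s.n), s.f i (w v) = v i := by
  obtain ⟨y, hy, hYy⟩ := s.isLinftyDual.2 s.n
  let M : (Fin s.n → ℝ) →ₗ[ℝ] (Fin s.n → ℝ) :=
    LinearMap.pi fun i => (s.f i).toLinearMap ∘ₗ y
  have hM : ∀ v, ‖M v - v‖ ≤ 2⁻¹ * ‖v‖ := fun v => by
    refine (pi_norm_le_iff_of_nonneg (by positivity)).2 fun i => ?_
    have h1 : (M v - v) i = (s.f i - s.Y i) (y v) := by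
      change s.f i (y v) - v i = s.f i (y v) - s.Y i (y v)
      rw [hYy]
    rw [h1]
    calc ‖(s.f i - s.Y i) (y v)‖ ≤ (2 * K)⁻¹ * ‖y v‖ :=
          ContinuousLinearMap.le_of_opNorm_le _ (s.near i i.2) _
      _ ≤ (2 * K)⁻¹ * (K * ‖v‖) := by gcongr; exact hy v
      _ = 2⁻¹ * ‖v‖ := by field_simp
  obtain ⟨M', hM', hn⟩ := exists_right_inverse M (c := 2⁻¹) (by norm_num) fun v => by
    have h1 := norm_sub_norm_le v (v - M v)
    rw [sub_sub_cancel, norm_sub_rev v (M v)] at h1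
    linarith [hM v]
  refine ⟨y ∘ₗ M', fun v => ?_, fun v i => congrFun (hM' v) i⟩
  calc ‖y (M' v)‖ ≤ K * (2⁻¹⁻¹ * ‖v‖) :=
        (hy _).trans (mul_le_mul_of_nonneg_left (hn v) (by linarith))
    _ = 2 * K * ‖v‖ := by rw [inv_inv]; ring

/-- The inductive step of the construction. -/
lemma Stage.exists_next {lam K : ℝ} (hX : LocallyLinfty X lam) (hK : 1 ≤ K) (hlam : 0 ≤ lam)
    (hinf : ¬FiniteDimensional ℝ X) (s : Stage X lam K) (x : X) :
    ∃ s' : Stage X lam K, s.n < s'.n ∧ (∀ k < s.n, s'.f k = s.f k) ∧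
      LinearMap.range s.u ≤ LinearMap.range s'.u ∧ x ∈ LinearMap.range s'.u := by
  have hK0 : 0 ≤ K := by linarith
  obtain ⟨w, hw, hfw⟩ := s.exists_dual hK
  obtain ⟨x₀, hx₀⟩ : ∃ x₀, x₀ ∉ LinearMap.range w := by
    by_contra! h
    have : LinearMap.range w = ⊤ := eq_top_iff.2 fun z _ => h z
    exact hinf (Module.Finite.of_surjective w (LinearMap.range_eq_top.1 this))
  let f : X →L[ℝ] (Fin s.n → ℝ) := ContinuousLinearMap.pi fun i => s.f i
  have hf : ∀ x, ‖f x‖ ≤ 2 * ‖x‖ := fun x =>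
    (pi_norm_le_iff_of_nonneg (by positivity)).2 fun i =>
      (s.f i).le_of_opNorm_le (s.norm_f_le hK i.2) x
  have := FiniteDimensional.span_of_finite ℝ (Set.toFinite {x, x₀})
  obtain ⟨N, B, g, hfB, hgB, hgw, hg, hB, hH⟩ := exists_complement hX hK0
    (by positivity : 0 ≤ 2 * K) s.isLinftyDual f w hf hw (fun v => funext fun i => hfw v i)
    (LinearMap.range s.u ⊔ Submodule.span ℝ {x, x₀})
  have hN : 0 < N := by
    rcases Nat.eq_zero_or_pos N with rfl | h
    · exfalso
      have hB0 : B = 0 := by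
        ext i
        exact i.elim0
      rw [hB0, LinearMap.range_zero, sup_bot_eq] at hH
      exact hx₀ (hH (Submodule.mem_sup_right (Submodule.subset_span (by simp))))
    · exact h
  obtain ⟨Y', hY', hYY', hF⟩ := s.isLinftyDual.exists_vanishing_tail hK0 s.n
    (LinearMap.range w ⊔ LinearMap.range B)
  set θ : ℝ := ((2 + 2 * (2 * K)) * (2 * K))⁻¹ with hθ
  have hθ0 : 0 < θ := by positivity
  let u : (Fin (s.n + N) → ℝ) →ₗ[ℝ] X := w ∘ₗ LinearMap.funLeft ℝ ℝ (Fin.castAdd N) +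
    B ∘ₗ (θ⁻¹ • LinearMap.funLeft ℝ ℝ (Fin.natAdd s.n))
  have hu : ∀ v, u v = w (fun i => v (Fin.castAdd N i)) +
    B (θ⁻¹ • fun i => v (Fin.natAdd s.n i)) := fun v => rfl
  have huF : LinearMap.range w ⊔ LinearMap.range B ≤ LinearMap.range u := by
    refine sup_le ?_ ?_
    · rintro _ ⟨v, rfl⟩
      refine ⟨Fin.append v 0, ?_⟩
      rw [hu]
      simp [← Pi.zero_def]
    · rintro _ ⟨v, rfl⟩
      refine ⟨Fin.append 0 (θ • v), ?_⟩
      rw [hu]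
      have : (fun i => Fin.append (0 : Fin s.n → ℝ) (θ • v) (Fin.natAdd s.n i)) = θ • v := by
        ext i; simp
      rw [this, inv_smul_smul₀ hθ0.ne']
      simp [← Pi.zero_def]
  have huF' : ∀ v, u v ∈ LinearMap.range w ⊔ LinearMap.range B := fun v => by
    rw [hu]
    exact Submodule.add_mem_sup ⟨_, rfl⟩ ⟨_, rfl⟩
  let f' : ℕ → X →L[ℝ] ℝ := fun k => if k < s.n then s.f k else
    if h : k - s.n < N then Y' k + θ • (ContinuousLinearMap.proj ⟨k - s.n, h⟩).comp g else 0
  have hf'1 : ∀ k < s.n, f' k = s.f k := fun k hk => if_pos hk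
  have hf'2 : ∀ i : Fin N, f' (s.n + i) =
      Y' (s.n + i) + θ • (ContinuousLinearMap.proj i).comp g := fun i => by
    simp only [f']
    rw [if_neg (by omega), dif_pos (by simp)]
    congr 4
    ext
    simp
  refine ⟨⟨s.n + N, Y', f', u, hY', fun k hk => ?_, fun v => ?_, fun v i => ?_⟩,
    Nat.lt_add_of_pos_right hN, hf'1, ?_, ?_⟩
  · by_cases hkn : k < s.n
    · rw [hf'1 k hkn, hYY' k hkn]
      exact s.near k hkn
    · obtain ⟨i, rfl⟩ : ∃ i : Fin N, k = s.n + i := ⟨⟨k - s.n, by omega⟩, by simp; omega⟩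
      rw [hf'2, add_sub_cancel_left]
      refine ContinuousLinearMap.opNorm_le_bound _ (by positivity) fun z => ?_
      change ‖θ • g z i‖ ≤ _
      rw [norm_smul, Real.norm_of_nonneg hθ0.le]
      calc θ * ‖g z i‖ ≤ θ * ((2 + 2 * (2 * K)) * ‖z‖) := by
            gcongr
            exact (norm_le_pi_norm (g z) i).trans (hg z)
        _ = (2 * K)⁻¹ * ‖z‖ := by rw [hθ]; field_simp
  · have h1 : ‖fun i => v (Fin.castAdd N i)‖ ≤ ‖v‖ :=
      (pi_norm_le_iff_of_nonneg (norm_nonneg v)).2 fun i => norm_le_pi_norm v _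
    have h2 : ‖θ⁻¹ • fun i => v (Fin.natAdd s.n i)‖ ≤ θ⁻¹ * ‖v‖ := by
      rw [norm_smul, norm_inv, Real.norm_of_nonneg hθ0.le]
      gcongr
      exact (pi_norm_le_iff_of_nonneg (norm_nonneg v)).2 fun i => norm_le_pi_norm v _
    rw [hu, stageConst, add_mul]
    refine (norm_add_le _ _).trans (add_le_add ((hw _).trans (by gcongr)) ((hB _).trans ?_))
    rw [mul_assoc]
    refine mul_le_mul_of_nonneg_left (h2.trans_eq ?_) (by positivity)
    rw [hθ, inv_inv]
  · induction i using Fin.addCases with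
    | left i =>
      change f' (i : ℕ) (u v) = _
      rw [hf'1 i i.2, hu, map_add, hfw]
      have : s.f i (B (θ⁻¹ • fun i => v (Fin.natAdd s.n i))) = 0 := congrFun (hfB _) i
      rw [this, add_zero]
    | right i =>
      change f' (s.n + i) (u v) = _
      rw [hf'2]
      change Y' (s.n + i) (u v) + θ • g (u v) i = _
      rw [hF _ (Nat.le_add_right _ _) _ (huF' v), hu, map_add, hgw, hgB]
      simp [hθ0.ne']
  · exact (le_sup_left.trans hH).trans huF
  · exact huF (hH (Submodule.mem_sup_right (Submodule.subset_span (by simp))))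

end Biorthogonal

section ExistsDual

/-- The mass that the functional `Y ∘ β` on `ℓ∞^N` gives to a set of coordinates. -/
def mass {N : ℕ} (β : (Fin N → ℝ) →ₗ[ℝ] X) (Y : X →L[ℝ] ℝ) (A : Finset (Fin N)) : ℝ :=
  ∑ t ∈ A, |Y (β (Pi.single t 1))|

variable {N : ℕ} {β : (Fin N → ℝ) →ₗ[ℝ] X} {Y : X →L[ℝ] ℝ}

lemma mass_nonneg (A : Finset (Fin N)) : 0 ≤ mass β Y A :=
  Finset.sum_nonneg fun _ _ => abs_nonneg _

lemma mass_mono {A B : Finset (Fin N)} (h : A ⊆ B) : mass β Y A ≤ mass β Y B :=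
  Finset.sum_le_sum_of_subset_of_nonneg h fun _ _ _ => abs_nonneg _

lemma mass_biUnion_le {ι : Type*} (S : Finset ι) (A : ι → Finset (Fin N)) :
    mass β Y (S.biUnion A) ≤ ∑ k ∈ S, mass β Y (A k) := by
  classical
  induction S using Finset.induction_on with
  | empty => simp [mass]
  | insert k S hk ih =>
    rw [Finset.biUnion_insert, Finset.sum_insert hk]
    refine le_trans ?_ (add_le_add_right ih _)
    simp only [mass]
    rw [← Finset.sum_union_inter]
    exact le_add_of_nonneg_right (mass_nonneg _)

lemma mass_univ_le {lam : ℝ} (hlam : 0 ≤ lam) (hβ : ∀ v, ‖β v‖ ≤ lam * ‖v‖) (hY : ‖Y‖ ≤ 1) :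
    mass β Y Finset.univ ≤ lam :=
  sum_abs_single_le (Y.toLinearMap ∘ₗ β) (fun v => by
    simpa using (Y.le_of_opNorm_le hY (β v)).trans (by simpa using hβ v)) hlam

lemma sum_mass_le_of_disjoint {lam : ℝ} (hlam : 0 ≤ lam) (hβ : ∀ v, ‖β v‖ ≤ lam * ‖v‖)
    (hY : ‖Y‖ ≤ 1) {ι : Type*} (S : Finset ι) (A : ι → Finset (Fin N))
    (hA : (S : Set ι).PairwiseDisjoint A) : ∑ k ∈ S, mass β Y (A k) ≤ lam := by
  classical
  unfold mass
  rw [← Finset.sum_biUnion hA]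
  exact (mass_mono (Finset.subset_univ _)).trans (mass_univ_le hlam hβ hY)

/-- Functionals that are almost concentrated on disjoint sets of coordinates of a copy of
`ℓ∞^N` have biorthogonal vectors dominated by the unit vector basis of `ℓ∞^n`. -/
lemma exists_biorthogonal {lam c : ℝ} (hlam : 0 ≤ lam) (hβ : ∀ v, ‖β v‖ ≤ lam * ‖v‖)
    (hc : 0 < c) {n : ℕ} (Z : Fin n → X →L[ℝ] ℝ) (A : Fin n → Finset (Fin N))
    (hA : Pairwise fun i j => Disjoint (A i) (A j))
    (h : ∀ j, ∑ k ∈ Finset.univ.erase j, mass β (Z j) (A k) + c ≤ mass β (Z j) (A j)) :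
    ∃ y : (Fin n → ℝ) →ₗ[ℝ] X, (∀ v, ‖y v‖ ≤ lam * c⁻¹ * ‖v‖) ∧ ∀ v i, Z i (y v) = v i := by
  let s : Fin n → Fin N → ℝ := fun k t => if t ∈ A k then
    (SignType.sign (Z k (β (Pi.single t 1))) : ℝ) else 0
  have hs : ∀ k t, |s k t| ≤ 1 := fun k t => by
    simp only [s]
    split_ifs
    · rcases SignType.sign (Z k (β (Pi.single t 1))) with _ | _ | _ <;> simp
    · simp
  let D : (Fin n → ℝ) →ₗ[ℝ] (Fin N → ℝ) := Fintype.linearCombination ℝ s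
  have hD : ∀ v t, D v t = ∑ k, v k * s k t := fun v t => by
    simp [D, Fintype.linearCombination_apply]
  have hDn : ∀ v, ‖D v‖ ≤ ‖v‖ := fun v => by
    refine (pi_norm_le_iff_of_nonneg (norm_nonneg v)).2 fun t => ?_
    rw [hD]
    by_cases ht : ∃ k, t ∈ A k
    · obtain ⟨k, hk⟩ := ht
      rw [Finset.sum_eq_single k (fun j _ hjk => ?_) (by simp), norm_mul]
      · exact (mul_le_of_le_one_right (norm_nonneg _) (hs k t)).trans (norm_le_pi_norm v k)
      · have : t ∉ A j := Finset.disjoint_left.1 (hA hjk.symm) hk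
        simp [s, this]
    · push Not at ht
      simp [s, ht]
  have hpair : ∀ j v, Z j (β (D v)) = ∑ k, v k * Z j (β (s k)) := fun j v => by
    simp [D, Fintype.linearCombination_apply]
  have hZs : ∀ j k, Z j (β (s k)) = ∑ t, s k t * Z j (β (Pi.single t 1)) := fun j k => by
    simpa using linear_apply_eq_sum ((Z j).toLinearMap ∘ₗ β) (s k)
  have hdiag : ∀ j, Z j (β (s j)) = mass β (Z j) (A j) := fun j => by
    rw [hZs, mass]
    simp only [s, ite_mul, zero_mul, sign_mul_self]
    simp
  have hoff : ∀ j k, |Z j (β (s k))| ≤ mass β (Z j) (A k) := fun j k => by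
    rw [hZs, mass, ← Finset.sum_subset (Finset.subset_univ (A k)) fun t _ ht => by simp [s, ht]]
    refine (Finset.abs_sum_le_sum_abs _ _).trans (Finset.sum_le_sum fun t _ => ?_)
    rw [abs_mul]
    exact mul_le_of_le_one_left (abs_nonneg _) (hs k t)
  let M : (Fin n → ℝ) →ₗ[ℝ] (Fin n → ℝ) := LinearMap.pi fun i => (Z i).toLinearMap ∘ₗ β ∘ₗ D
  obtain ⟨M', hM', hn⟩ := exists_right_inverse M hc fun v => by
    rcases isEmpty_or_nonempty (Fin n) with he | he
    · have : v = 0 := Subsingleton.elim _ _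
      simp [this]
    · obtain ⟨j, hj⟩ := Finite.exists_max fun i => |v i|
      have hv : ‖v‖ = |v j| := le_antisymm
        ((pi_norm_le_iff_of_nonneg (abs_nonneg _)).2 hj) (norm_le_pi_norm v j)
      have h1 : M v j = v j * mass β (Z j) (A j) +
          ∑ k ∈ Finset.univ.erase j, v k * Z j (β (s k)) := by
        rw [← hdiag, Finset.add_sum_erase _ (fun k => v k * Z j (β (s k))) (Finset.mem_univ j)]
        exact hpair j v
      have h2 : |∑ k ∈ Finset.univ.erase j, v k * Z j (β (s k))| ≤
          |v j| * ∑ k ∈ Finset.univ.erase j, mass β (Z j) (A k) := by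
        rw [Finset.mul_sum]
        refine (Finset.abs_sum_le_sum_abs _ _).trans (Finset.sum_le_sum fun k _ => ?_)
        rw [abs_mul]
        exact mul_le_mul (hj k) (hoff j k) (abs_nonneg _) (abs_nonneg _)
      have h3 : |v j * mass β (Z j) (A j)| = |v j| * mass β (Z j) (A j) := by
        rw [abs_mul, abs_of_nonneg (mass_nonneg _)]
      have h4 : |v j * mass β (Z j) (A j)| ≤
          |M v j| + |∑ k ∈ Finset.univ.erase j, v k * Z j (β (s k))| := by
        rw [eq_sub_of_add_eq h1.symm]
        exact abs_sub _ _
      have h5 := mul_le_mul_of_nonneg_left (h j) (abs_nonneg (v j))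
      have h6 : |M v j| ≤ ‖M v‖ := norm_le_pi_norm (M v) j
      rw [hv]
      nlinarith
  refine ⟨β ∘ₗ D ∘ₗ M', fun v => ?_, fun v i => congrFun (hM' v) i⟩
  calc ‖β (D (M' v))‖ ≤ lam * (c⁻¹ * ‖v‖) :=
        (hβ _).trans (mul_le_mul_of_nonneg_left ((hDn _).trans (hn v)) hlam)
    _ = lam * c⁻¹ * ‖v‖ := by ring

/-- A choice, for every finite set `s`, of a copy of `ℓ∞^N` containing `s`. -/
structure LocalCharts (X : Type*) [NormedAddCommGroup X] [NormedSpace ℝ X] (lam : ℝ) where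
  N : Finset X → ℕ
  α : ∀ s, X →L[ℝ] (Fin (N s) → ℝ)
  β : ∀ s, (Fin (N s) → ℝ) →ₗ[ℝ] X
  norm_α : ∀ s x, ‖α s x‖ ≤ ‖x‖
  norm_β : ∀ s v, ‖β s v‖ ≤ lam * ‖v‖
  β_α : ∀ s, ∀ x ∈ s, β s (α s x) = x

lemma LocallyLinfty.nonempty_localCharts {lam : ℝ} (hX : LocallyLinfty X lam) :
    Nonempty (LocalCharts X lam) := by
  choose N α β hα hβ hαβ hF using fun s : Finset X =>
    hX (Submodule.span ℝ (s : Set X)) inferInstance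
  refine ⟨⟨N, α, β, hα, hβ, fun s x hx => ?_⟩⟩
  obtain ⟨v, rfl⟩ := hF s (Submodule.subset_span hx)
  rw [hαβ]

/-- Given finitely many functionals, there is a functional `V` and sets `F s` of coordinates
which have large mass for `V` and small mass for the given functionals. -/
lemma LocalCharts.exists_concentrated {lam : ℝ} (hX : LocallyLinfty X lam) (hlam : 1 ≤ lam)
    (hinf : ¬FiniteDimensional ℝ X) (c : LocalCharts X lam) (U : Ultrafilter (Finset X))
    (hU : (U : Filter (Finset X)) ≤ atTop) {ι : Type*} (S : Finset ι) (Z : ι → X →L[ℝ] ℝ)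
    (hZ : ∀ j ∈ S, ‖Z j‖ ≤ 1) {ε : ℝ} (hε : 0 < ε) :
    ∃ (V : X →L[ℝ] ℝ) (F : ∀ s, Finset (Fin (c.N s))), ‖V‖ ≤ 1 ∧
      (∀ᶠ s in U, (2 * lam)⁻¹ ≤ mass (c.β s) V (F s)) ∧
      ∀ j ∈ S, ∀ᶠ s in U, mass (c.β s) (Z j) (F s) ≤ ε := by
  classical
  have hlam0 : 0 < lam := by linarith
  obtain ⟨n, hn⟩ := exists_nat_gt ((2 * lam) * (lam * (S.card * lam)) / ε)
  rw [div_lt_iff₀ hε] at hn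
  obtain ⟨V, u, hV, hu, hVu⟩ := hX.exists_embedding hlam0.le hinf n
  let a : ∀ s, Fin n → Fin (c.N s) → ℝ := fun s i t => |c.α s (u (Pi.single i 1)) t|
  let F : Fin n → ∀ s, Finset (Fin (c.N s)) := fun i s =>
    Finset.univ.filter fun t => (2 * lam)⁻¹ ≤ a s i t
  have ha : ∀ s t, ∑ i, a s i t ≤ lam := fun s t =>
    sum_abs_single_le ((LinearMap.proj t) ∘ₗ (c.α s).toLinearMap ∘ₗ u)
      (fun v => ((norm_le_pi_norm (c.α s (u v)) t).trans (c.norm_α s _)).trans (hu v)) hlam0.le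
  have hale : ∀ s i t, a s i t ≤ lam := fun s i t =>
    (Finset.single_le_sum (f := fun i => a s i t) (fun _ _ => abs_nonneg _)
      (Finset.mem_univ i)).trans (ha s t)
  have hlarge : ∀ i s, u (Pi.single i 1) ∈ s → (2 * lam)⁻¹ ≤ mass (c.β s) (V i) (F i s) := by
    intro i s hs
    have h1 : (1 : ℝ) = ∑ t, c.α s (u (Pi.single i 1)) t * V i (c.β s (Pi.single t 1)) := by
      have h2 := linear_apply_eq_sum ((V i).toLinearMap ∘ₗ c.β s) (c.α s (u (Pi.single i 1)))
      simp only [LinearMap.comp_apply, ContinuousLinearMap.coe_coe, smul_eq_mul] at h2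
      rw [← h2, c.β_α s _ hs, hVu]
      simp
    have h2 : (1 : ℝ) ≤ ∑ t, a s i t * |V i (c.β s (Pi.single t 1))| := by
      calc (1 : ℝ) ≤ |∑ t, c.α s (u (Pi.single i 1)) t * V i (c.β s (Pi.single t 1))| := by
            rw [← h1, abs_one]
        _ ≤ _ := (Finset.abs_sum_le_sum_abs _ _).trans_eq
            (Finset.sum_congr rfl fun t _ => abs_mul _ _)
    have h3 : ∑ t, a s i t * |V i (c.β s (Pi.single t 1))| ≤
        lam * mass (c.β s) (V i) (F i s) + (2 * lam)⁻¹ * mass (c.β s) (V i) Finset.univ := by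
      rw [mass, mass, Finset.mul_sum, Finset.mul_sum, Finset.sum_filter, ← Finset.sum_add_distrib]
      refine Finset.sum_le_sum fun t _ => ?_
      have h0 := abs_nonneg (V i (c.β s (Pi.single t 1)))
      split_ifs with h
      · have := mul_le_mul_of_nonneg_right (hale s i t) h0
        have : 0 ≤ (2 * lam)⁻¹ * |V i (c.β s (Pi.single t 1))| := by positivity
        linarith
      · rw [zero_add]
        exact mul_le_mul_of_nonneg_right (not_le.1 h).le h0
    have h4 := mul_le_mul_of_nonneg_left (mass_univ_le hlam0.le (c.norm_β s) (hV i))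
      (by positivity : 0 ≤ (2 * lam)⁻¹)
    have h5 : (2 * lam)⁻¹ * lam = 1 / 2 := by field_simp
    rw [inv_le_iff_one_le_mul₀' (by positivity)]
    linarith
  have hsmall : ∀ s, ∃ i, ∑ j ∈ S, mass (c.β s) (Z j) (F i s) ≤ ε := by
    intro s
    have h1 : ∀ j ∈ S, ∑ i, mass (c.β s) (Z j) (F i s) ≤ 2 * lam * (lam * lam) := by
      intro j hj
      have h2 : ∀ i, mass (c.β s) (Z j) (F i s) ≤
          2 * lam * ∑ t, a s i t * |Z j (c.β s (Pi.single t 1))| := fun i => by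
        rw [mass, Finset.sum_filter, Finset.mul_sum]
        refine Finset.sum_le_sum fun t _ => ?_
        have h0 := abs_nonneg (Z j (c.β s (Pi.single t 1)))
        split_ifs with h
        · have h3 : 1 ≤ 2 * lam * a s i t := by
            rwa [inv_le_iff_one_le_mul₀' (by positivity)] at h
          nlinarith
        · have : 0 ≤ a s i t := abs_nonneg _
          positivity
      refine (Finset.sum_le_sum fun i _ => h2 i).trans ?_
      rw [← Finset.mul_sum, Finset.sum_comm]
      refine mul_le_mul_of_nonneg_left ?_ (by positivity)
      calc ∑ t, ∑ i, a s i t * |Z j (c.β s (Pi.single t 1))|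
          ≤ ∑ t, lam * |Z j (c.β s (Pi.single t 1))| := Finset.sum_le_sum fun t _ => by
            rw [← Finset.sum_mul]
            exact mul_le_mul_of_nonneg_right (ha s t) (abs_nonneg _)
        _ ≤ lam * lam := by
            rw [← Finset.mul_sum]
            exact mul_le_mul_of_nonneg_left (mass_univ_le hlam0.le (c.norm_β s) (hZ j hj))
              hlam0.le
    by_contra! hcon
    have h3 : (n : ℝ) * ε ≤ ∑ i, ∑ j ∈ S, mass (c.β s) (Z j) (F i s) := by
      simpa using Finset.card_nsmul_le_sum (Finset.univ : Finset (Fin n)) _ ε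
        fun i _ => (hcon i).le
    rw [Finset.sum_comm] at h3
    have h4 := Finset.sum_le_card_nsmul S _ _ h1
    rw [nsmul_eq_mul] at h4
    linarith
  obtain ⟨i, hi⟩ : ∃ i, ∀ᶠ s in U, ∑ j ∈ S, mass (c.β s) (Z j) (F i s) ≤ ε := by
    have := (Ultrafilter.finite_biUnion_mem_iff (f := U) (Set.finite_univ (α := Fin n))
      (s := fun i => {s | ∑ j ∈ S, mass (c.β s) (Z j) (F i s) ≤ ε})).1 (by
        refine Filter.univ_mem' fun s => ?_
        obtain ⟨i, hi⟩ := hsmall s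
        exact Set.mem_biUnion (Set.mem_univ i) hi)
    obtain ⟨i, -, hi⟩ := this
    exact ⟨i, hi⟩
  refine ⟨V i, F i, hV i, ?_, fun j hj => ?_⟩
  · filter_upwards [hU (eventually_ge_atTop {u (Pi.single i 1)})] with s hs
    exact hlarge i s (hs (Finset.mem_singleton_self _))
  · filter_upwards [hi] with s hs
    exact (Finset.single_le_sum (f := fun j => mass (c.β s) (Z j) (F i s))
      (fun _ _ => mass_nonneg _) hj).trans hs

lemma LocalCharts.exists_seq {lam : ℝ} (hX : LocallyLinfty X lam) (hlam : 1 ≤ lam)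
    (hinf : ¬FiniteDimensional ℝ X) (c : LocalCharts X lam) (U : Ultrafilter (Finset X))
    (hU : (U : Filter (Finset X)) ≤ atTop) {ε : ℝ} (hε : 0 < ε) :
    ∃ (Y : ℕ → X →L[ℝ] ℝ) (F : ℕ → ∀ s, Finset (Fin (c.N s))), (∀ k, ‖Y k‖ ≤ 1) ∧
      (∀ k, ∀ᶠ s in U, (2 * lam)⁻¹ ≤ mass (c.β s) (Y k) (F k s)) ∧
      ∀ j k, j < k → ∀ᶠ s in U, mass (c.β s) (Y j) (F k s) ≤ ε * (1 / 2) ^ k := by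
  classical
  obtain ⟨z, hz, hr⟩ := exists_seq_of_forall_finset_exists
    (α := (X →L[ℝ] ℝ) × (∀ s, Finset (Fin (c.N s))) × ℕ)
    (fun z => ‖z.1‖ ≤ 1 ∧ ∀ᶠ s in U, (2 * lam)⁻¹ ≤ mass (c.β s) z.1 (z.2.1 s))
    (fun z z' => z.2.2 < z'.2.2 ∧ ∀ᶠ s in U, mass (c.β s) z.1 (z'.2.1 s) ≤ ε * (1 / 2) ^ z'.2.2)
    fun S hS => by
      obtain ⟨V, F, hV, hF, hS'⟩ := c.exists_concentrated hX hlam hinf U hU S (fun z => z.1)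
        (fun z hz => (hS z hz).1)
        (by positivity : 0 < ε * (1 / 2) ^ (S.sup (fun z => z.2.2) + 1))
      exact ⟨(V, F, S.sup (fun z => z.2.2) + 1), ⟨hV, hF⟩, fun z hz =>
        ⟨Nat.lt_succ_of_le (Finset.le_sup (f := fun z => z.2.2) hz), hS' z hz⟩⟩
  have hidx : StrictMono fun k => (z k).2.2 := fun i j h => (hr i j h).1
  refine ⟨fun k => (z k).1, fun k => (z k).2.1, fun k => (hz k).1, fun k => (hz k).2,
    fun j k hjk => (hr j k hjk).2.mono fun s hs => hs.trans ?_⟩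
  exact mul_le_mul_of_nonneg_left
    (pow_le_pow_of_le_one (by norm_num) (by norm_num) (hidx.id_le k)) hε.le

lemma sum_half_pow_le_two (S : Finset ℕ) : ∑ k ∈ S, (1 / 2 : ℝ) ^ k ≤ 2 :=
  (summable_geometric_two.sum_le_tsum S fun _ _ => by positivity).trans_eq
    tsum_geometric_two

/-- In an infinite-dimensional `ℒ∞`-space there is a sequence of functionals all of whose finite
segments have uniformly dominated biorthogonal vectors. -/
lemma exists_isLinftyDual {lam : ℝ} (hX : LocallyLinfty X lam) (hlam : 1 ≤ lam)
    (hinf : ¬FiniteDimensional ℝ X) :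
    ∃ (K : ℝ) (Y : ℕ → X →L[ℝ] ℝ), 1 ≤ K ∧ IsLinftyDual K Y := by
  classical
  have hlam0 : 0 < lam := by linarith
  obtain ⟨c⟩ := hX.nonempty_localCharts
  let U : Ultrafilter (Finset X) := Ultrafilter.of atTop
  set δ := (2 * lam)⁻¹ with hδ
  have hδ0 : 0 < δ := by positivity
  set ε := δ / 12 with hε
  have hε0 : 0 < ε := by positivity
  obtain ⟨Y, F, hY, hlarge, hsmall⟩ := c.exists_seq hX hlam hinf U (Ultrafilter.of_le _) hε0
  let A : ℕ → ℕ → ∀ s, Finset (Fin (c.N s)) := fun m k s =>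
    F k s \ (Finset.Ioo k m).biUnion fun i => F i s
  have hAdisj : ∀ m s k l, k < m → l < m → k ≠ l → Disjoint (A m k s) (A m l s) := by
    have key : ∀ m s k l, l < m → k < l → Disjoint (A m k s) (A m l s) := by
      intro m s k l hl hkl
      rw [Finset.disjoint_left]
      intro t ht ht'
      refine (Finset.mem_sdiff.1 ht).2 (Finset.mem_biUnion.2 ⟨l, ?_, (Finset.mem_sdiff.1 ht').1⟩)
      exact Finset.mem_Ioo.2 ⟨hkl, hl⟩
    intro m s k l hk hl hkl
    rcases lt_or_gt_of_ne hkl with h | h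
    · exact key m s k l hl h
    · exact (key m s l k hk h).symm
  have hlim : ∀ j k, ∃ a, Tendsto (fun s => mass (c.β s) (Y j) (A (j + 1) k s)) U (𝓝 a) := by
    intro j k
    have hmem : ∀ s, mass (c.β s) (Y j) (A (j + 1) k s) ∈ Set.Icc 0 lam := fun s =>
      ⟨mass_nonneg _, (mass_mono (Finset.subset_univ _)).trans
        (mass_univ_le hlam0.le (c.norm_β s) (hY j))⟩
    obtain ⟨a, -, ha⟩ := (isCompact_Icc (a := (0 : ℝ)) (b := lam)).ultrafilter_le_nhds
      (U.map fun s => mass (c.β s) (Y j) (A (j + 1) k s))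
      (by
        rw [Filter.le_principal_iff]
        exact Filter.mem_map.2 (Filter.univ_mem' hmem))
    exact ⟨a, ha⟩
  choose a ha using hlim
  have ha0 : ∀ j k, 0 ≤ a j k := fun j k => ge_of_tendsto' (ha j k) fun s => mass_nonneg _
  obtain ⟨m₀, hm₀⟩ := exists_nat_gt (lam / ε)
  rw [div_lt_iff₀ hε0] at hm₀
  obtain ⟨φ, hφ, hφa⟩ := rosenthal hε0 m₀ (fun j k => if k < j then a j k else 0) fun j S => by
    rw [← Finset.sum_filter]
    refine le_trans (le_of_tendsto' (tendsto_finsetSum _ fun k _ => ha j k) fun s => ?_) hm₀.le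
    refine sum_mass_le_of_disjoint hlam0.le (c.norm_β s) (hY j) _ (fun k => A (j + 1) k s) ?_
    intro k hk l hl hkl
    have hk' := (Finset.mem_filter.1 hk).2
    have hl' := (Finset.mem_filter.1 hl).2
    exact hAdisj _ s k l (by omega) (by omega) hkl
  have hrow : ∀ j (S : Finset ℕ), j ∉ S →
      ∑ k ∈ S, (if φ k < φ j then a (φ j) (φ k) else 0) ≤ ε := hφa
  refine ⟨lam * (δ / 2)⁻¹, Y ∘ φ, ?_, fun k => hY _, fun n => ?_⟩
  · rw [hδ]
    have : lam * ((2 * lam)⁻¹ / 2)⁻¹ = 4 * lam ^ 2 := by field_simp; norm_num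
    rw [this]
    nlinarith
  · set m := (Finset.range n).sup φ + 1 with hm
    have hφm : ∀ k < n, φ k < m := fun k hk =>
      Nat.lt_succ_of_le (Finset.le_sup (f := φ) (Finset.mem_range.2 hk))
    set η := ε / (n + 1) with hη
    have hη0 : 0 < η := by positivity
    have hev : ∀ᶠ s in (U : Filter (Finset X)),
        (∀ k ∈ Finset.range m, δ ≤ mass (c.β s) (Y k) (F k s)) ∧
        (∀ p ∈ Finset.range m ×ˢ Finset.range m, p.1 < p.2 →
          mass (c.β s) (Y p.1) (F p.2 s) ≤ ε * (1 / 2) ^ p.2) ∧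
        ∀ p ∈ Finset.range m ×ˢ Finset.range m,
          mass (c.β s) (Y p.1) (A (p.1 + 1) p.2 s) ≤ a p.1 p.2 + η := by
      refine Filter.Eventually.and ?_ (Filter.Eventually.and ?_ ?_)
      · exact (Filter.eventually_all_finset _).2 fun k _ => hlarge k
      · refine (Filter.eventually_all_finset _).2 fun p _ => ?_
        by_cases hp : p.1 < p.2
        · exact (hsmall _ _ hp).mono fun s hs _ => hs
        · exact Filter.Eventually.of_forall fun s h => absurd h hp
      · exact (Filter.eventually_all_finset _).2 fun p _ =>
          (ha p.1 p.2).eventually_le_const (lt_add_of_pos_right _ hη0)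
    obtain ⟨s, h1, h2, h3⟩ := hev.exists
    refine exists_biorthogonal hlam0.le (c.norm_β s) (by positivity) (fun k : Fin n => Y (φ k))
      (fun k => A m (φ k) s) (fun i j hij => hAdisj m s _ _ (hφm i i.2) (hφm j j.2)
        fun h => hij (Fin.ext (hφ h))) fun j => ?_
    have hjm := hφm j j.2
    have hdiag : δ - 2 * ε ≤ mass (c.β s) (Y (φ j)) (A m (φ j) s) := by
      have h4 : mass (c.β s) (Y (φ j)) (F (φ j) s) ≤ mass (c.β s) (Y (φ j)) (A m (φ j) s) +
          ∑ i ∈ Finset.Ioo (φ j) m, mass (c.β s) (Y (φ j)) (F i s) := by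
        refine (mass_mono (B := A m (φ j) s ∪ (Finset.Ioo (φ j) m).biUnion fun i => F i s)
          fun t ht => ?_).trans ?_
        · by_cases h : t ∈ (Finset.Ioo (φ j) m).biUnion fun i => F i s
          · exact Finset.mem_union_right _ h
          · exact Finset.mem_union_left _ (Finset.mem_sdiff.2 ⟨ht, h⟩)
        · have h5 : Disjoint (A m (φ j) s) ((Finset.Ioo (φ j) m).biUnion fun i => F i s) :=
            Finset.sdiff_disjoint
          rw [mass, Finset.sum_union h5]
          refine add_le_add_right ?_ _
          exact mass_biUnion_le _ _
      have h5 : ∑ i ∈ Finset.Ioo (φ j) m, mass (c.β s) (Y (φ j)) (F i s) ≤ 2 * ε := by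
        calc _ ≤ ∑ i ∈ Finset.Ioo (φ j) m, ε * (1 / 2 : ℝ) ^ i := Finset.sum_le_sum fun i hi => by
              rw [Finset.mem_Ioo] at hi
              exact h2 (φ j, i) (by simp; omega) hi.1
          _ ≤ 2 * ε := by
              rw [← Finset.mul_sum]
              nlinarith [sum_half_pow_le_two (Finset.Ioo (φ j) m)]
      have := h1 (φ j) (Finset.mem_range.2 hjm)
      linarith
    have hoff : ∑ k ∈ Finset.univ.erase j, mass (c.β s) (Y (φ j)) (A m (φ k) s) ≤ 4 * ε := by
      have h4 : ∀ k ∈ Finset.univ.erase j, mass (c.β s) (Y (φ j)) (A m (φ k) s) ≤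
          ε * (1 / 2) ^ φ k + ((if φ k < φ j then a (φ j) (φ k) else 0) + η) := by
        intro k hk
        have hkm := hφm k k.2
        have hkj : φ k ≠ φ j := fun h => (Finset.mem_erase.1 hk).1 (Fin.ext (hφ h))
        have hp : (0 : ℝ) ≤ ε * (1 / 2) ^ φ k := by positivity
        rcases lt_or_gt_of_ne hkj with h | h
        · rw [if_pos h]
          have h5 : A m (φ k) s ⊆ A (φ j + 1) (φ k) s := by
            refine Finset.sdiff_subset_sdiff subset_rfl
              (Finset.biUnion_subset_biUnion_of_subset_left _ ?_)
            exact Finset.Ioo_subset_Ioo_right hjm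
          have h6 := h3 (φ j, φ k) (by simp; omega)
          linarith [mass_mono (β := c.β s) (Y := Y (φ j)) h5]
        · have h5 := h2 (φ j, φ k) (by simp; omega) h
          rw [if_neg (by omega)]
          have h6 : A m (φ k) s ⊆ F (φ k) s := Finset.sdiff_subset
          linarith [mass_mono (β := c.β s) (Y := Y (φ j)) h6]
      refine (Finset.sum_le_sum h4).trans ?_
      rw [Finset.sum_add_distrib, Finset.sum_add_distrib, ← Finset.mul_sum]
      have h5 : ∑ k ∈ Finset.univ.erase j, (1 / 2 : ℝ) ^ φ k ≤ 2 := by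
        have := sum_half_pow_le_two ((Finset.univ.erase j).image fun k : Fin n => φ k)
        rwa [Finset.sum_image fun x _ y _ h => Fin.ext (hφ h)] at this
      have h6 : ∑ k ∈ Finset.univ.erase j, (if φ k < φ j then a (φ j) (φ k) else 0) ≤ ε := by
        have := hrow j ((Finset.univ.erase j).image fun k : Fin n => (k : ℕ)) (by
          intro h
          obtain ⟨k, hk, hkj⟩ := Finset.mem_image.1 h
          exact (Finset.mem_erase.1 hk).1 (Fin.ext hkj))
        rwa [Finset.sum_image fun x _ y _ h => Fin.ext h] at this
      have h7 : ∑ k ∈ Finset.univ.erase j, η ≤ ε := by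
        rw [Finset.sum_const, nsmul_eq_mul, hη, mul_div_assoc', div_le_iff₀ (by positivity)]
        have : ((Finset.univ.erase j).card : ℝ) ≤ n := by
          exact_mod_cast (Finset.card_le_univ _).trans (by simp)
        nlinarith
      nlinarith
    linarith

end ExistsDual

end LinftyBD

namespace BD

variable {Γ : Type*}

lemma System.mem_rk (S : System Γ) (γ : Γ) : γ ∈ S.Γs (S.rk γ) := by
  classical
  exact Nat.find_spec (S.covers γ)

lemma System.rk_le (S : System Γ) {γ : Γ} {q : ℕ} (h : γ ∈ S.Γs q) : S.rk γ ≤ q := by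
  classical
  exact Nat.find_min' (S.covers γ) h

open Classical in
lemma System.dvec_eq (S : System Γ) {q : ℕ} (γ : ↥(S.Γs q)) (h : S.rk γ = q) :
    S.dvec γ = S.i q (Pi.single γ 1) := by
  obtain ⟨γ, hγ⟩ := γ
  change S.rk γ = q at h
  subst h
  rw [System.dvec]
  congr 1
  ext δ
  simp [Pi.single_apply, Subtype.ext_iff]

lemma System.i_mem_span_of_rk (S : System Γ) (q : ℕ) (x : ↥(S.Γs q) → ℝ)
    (hx : ∀ γ : ↥(S.Γs q), S.rk γ ≠ q → x γ = 0) :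
    S.i q x ∈ Submodule.span ℝ (Set.range S.dvec) := by
  classical
  rw [show S.i q x = _ from LinftyBD.linear_apply_eq_sum (S.i q).toLinearMap x]
  refine Submodule.sum_mem _ fun γ _ => ?_
  by_cases h : S.rk γ = q
  · refine Submodule.smul_mem _ _ (Submodule.subset_span ⟨γ, ?_⟩)
    exact S.dvec_eq γ h
  · rw [hx γ h, zero_smul]
    exact Submodule.zero_mem _

/-- The range of each extension operator lies in the span of the vectors `d_γ`. -/
lemma System.i_mem_span (S : System Γ) (q : ℕ) (x : ↥(S.Γs q) → ℝ) :
    S.i q x ∈ Submodule.span ℝ (Set.range S.dvec) := by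
  induction q with
  | zero =>
    exact S.i_mem_span_of_rk 0 x fun γ h => absurd (Nat.le_zero.1 (S.rk_le γ.2)) h
  | succ q ih =>
    have hle : S.Γs q ⊆ S.Γs (q + 1) := S.strict.monotone q.le_succ
    let y : Linf Γ := S.i q fun γ => x ⟨γ, hle γ.2⟩
    have hy : S.i (q + 1) (restrCLM (S.Γs (q + 1)) y) = y :=
      (S.compat q (q + 1) q.lt_succ_self _).symm
    have hx : S.i (q + 1) x = S.i (q + 1) (x - restrCLM (S.Γs (q + 1)) y) + y := by
      rw [map_sub, hy, sub_add_cancel]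
    rw [hx]
    refine Submodule.add_mem _ (S.i_mem_span_of_rk _ _ fun γ hγ => ?_) (ih _)
    have hrk : S.rk γ ≤ q := by have := S.rk_le γ.2; omega
    have hγq : (γ : Γ) ∈ S.Γs q := S.strict.monotone hrk (S.mem_rk γ)
    have := S.extension q (fun γ => x ⟨γ, hle γ.2⟩) ⟨γ, hγq⟩
    exact sub_eq_zero.2 this.symm

/-- A closed subspace of `ℓ∞(Γ)` that contains the ranges of all extension operators, and in
which their union is dense, is the Bourgain-Delbaen space. -/
lemma System.space_eq (S : System Γ) (V : Submodule ℝ (Linf Γ)) (hV : IsClosed (V : Set (Linf Γ)))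
    (hi : ∀ q x, S.i q x ∈ V)
    (hd : (V : Set (Linf Γ)) ⊆ closure (⋃ q, Set.range (S.i q))) : V = S.space := by
  refine le_antisymm (fun v hv => ?_) (Submodule.topologicalClosure_minimal _ ?_ hV)
  · refine closure_mono ?_ (hd hv)
    rintro - ⟨-, ⟨q, rfl⟩, x, rfl⟩
    exact S.i_mem_span q x
  · rw [Submodule.span_le]
    rintro - ⟨γ, rfl⟩
    exact hi _ _

end BD

namespace LinftyBD

section Assembly

variable {X : Type*} [NormedAddCommGroup X] [NormedSpace ℝ X]

/-- The operator `x ↦ (f k x)_k` into `ℓ∞`. -/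
def coordMap (f : ℕ → X →L[ℝ] ℝ) {C : ℝ} (hf : ∀ k, ‖f k‖ ≤ C) : X →L[ℝ] Linf ℕ :=
  LinearMap.mkContinuous
    { toFun := fun x => ⟨fun k => f k x, memℓp_infty ⟨C * ‖x‖, by
        rintro - ⟨k, rfl⟩
        exact (f k).le_of_opNorm_le (hf k) x⟩⟩
      map_add' := fun x y => by ext k; exact map_add (f k) x y
      map_smul' := fun a x => by ext k; exact map_smul (f k) a x } C fun x =>
    lp.norm_le_of_forall_le
      (mul_nonneg ((norm_nonneg _).trans (hf 0)) (norm_nonneg x))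
      fun k => (f k).le_of_opNorm_le (hf k) x

lemma norm_coordMap_le (f : ℕ → X →L[ℝ] ℝ) {C : ℝ} (hf : ∀ k, ‖f k‖ ≤ C) (x : X) :
    ‖coordMap f hf x‖ ≤ C * ‖x‖ :=
  lp.norm_le_of_forall_le (mul_nonneg ((norm_nonneg _).trans (hf 0)) (norm_nonneg x))
    fun k => (f k).le_of_opNorm_le (hf k) x

variable {f : ℕ → X →L[ℝ] ℝ} {C D : ℝ} {n : ℕ → ℕ}
  {u : ∀ p, (↥(Finset.range (n p)) → ℝ) →ₗ[ℝ] X}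

lemma apply_eq_of_mem_range {p : ℕ} (hfu : ∀ v i, f i.1 (u p v) = v i) {x : X}
    (hx : x ∈ LinearMap.range (u p)) : u p (fun i => f i.1 x) = x := by
  obtain ⟨v, rfl⟩ := hx
  congr 1
  ext i
  exact hfu v i

/-- The system of extension operators given by biorthogonal vectors and functionals. -/
def system (hf : ∀ k, ‖f k‖ ≤ C) (hn : StrictMono n) (hn0 : ∀ p, 0 < n p)
    (hu : ∀ p v, ‖u p v‖ ≤ D * ‖v‖) (hfu : ∀ p v i, f i.1 (u p v) = v i)
    (hmono : ∀ p q, p < q → LinearMap.range (u p) ≤ LinearMap.range (u q)) : BD.System ℕ :=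
  have hbound : ∀ p v, ‖coordMap f hf (u p v)‖ ≤ C * D * ‖v‖ := fun p v => by
    rw [mul_assoc]
    exact (norm_coordMap_le f hf _).trans
      (mul_le_mul_of_nonneg_left (hu p v) ((norm_nonneg _).trans (hf 0)))
  { Γs := fun p => Finset.range (n p)
    strict := Finset.strictMono_range.comp hn
    nonempty := fun p => Finset.nonempty_range_iff.2 (hn0 p).ne'
    covers := fun γ => ⟨γ + 1, Finset.mem_range.2 (Nat.lt_of_lt_of_le γ.lt_succ_self hn.le_apply)⟩
    i := fun p => LinearMap.mkContinuous ((coordMap f hf).toLinearMap ∘ₗ u p) (C * D) (hbound p)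
    extension := fun p v i => hfu p v i
    compat := fun p q h v => congrArg (coordMap f hf)
      (apply_eq_of_mem_range (hfu q) (hmono p q h ⟨v, rfl⟩)).symm
    bdd := ⟨max (C * D) 0, by
      rintro - ⟨p, rfl⟩
      exact LinearMap.mkContinuous_norm_le' _ (hbound p)⟩ }

lemma nonempty_equiv_space [CompleteSpace X] (hf : ∀ k, ‖f k‖ ≤ C) (hn : StrictMono n)
    (hn0 : ∀ p, 0 < n p) (hu : ∀ p v, ‖u p v‖ ≤ D * ‖v‖) (hfu : ∀ p v i, f i.1 (u p v) = v i)
    (hmono : ∀ p q, p < q → LinearMap.range (u p) ≤ LinearMap.range (u q))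
    (hdense : Dense (⋃ p, (LinearMap.range (u p) : Set X))) :
    ∃ S : BD.System ℕ, Nonempty (X ≃L[ℝ] ↥S.space) := by
  let S := system hf hn hn0 hu hfu hmono
  let Ψ := coordMap f hf
  have hlow : ∀ x, ‖x‖ ≤ D.toNNReal * ‖Ψ x‖ := by
    intro x
    have hclosed : IsClosed {x | ‖x‖ ≤ D.toNNReal * ‖Ψ x‖} :=
      isClosed_le continuous_norm (continuous_const.mul Ψ.continuous.norm)
    refine closure_minimal ?_ hclosed (hdense x)
    intro y hy
    obtain ⟨p, v, rfl⟩ := Set.mem_iUnion.1 hy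
    have h1 : ‖v‖ ≤ ‖Ψ (u p v)‖ := (pi_norm_le_iff_of_nonneg (norm_nonneg _)).2 fun i => by
      rw [← hfu p v i]
      exact lp.norm_apply_le_norm ENNReal.top_ne_zero (Ψ (u p v)) i.1
    exact (hu p v).trans (mul_le_mul (Real.le_coe_toNNReal D) h1 (norm_nonneg v) (by positivity))
  have hanti : AntilipschitzWith D.toNNReal Ψ := AddMonoidHomClass.antilipschitz_of_bound Ψ hlow
  have hclosed : IsClosed (Set.range Ψ) := hanti.isClosed_range Ψ.uniformContinuous
  have hspace : LinearMap.range Ψ.toLinearMap = S.space := by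
    refine S.space_eq _ hclosed (fun q v => ⟨u q v, rfl⟩) ?_
    rintro - ⟨x, rfl⟩
    refine closure_mono ?_ (image_closure_subset_closure_image Ψ.continuous ⟨x, hdense x, rfl⟩)
    rintro - ⟨y, hy, rfl⟩
    obtain ⟨p, v, rfl⟩ := Set.mem_iUnion.1 hy
    exact Set.mem_iUnion.2 ⟨p, v, rfl⟩
  refine ⟨S, ?_⟩
  rw [← hspace]
  exact ⟨Ψ.equivRange hanti.injective hclosed⟩

end Assembly

section Main

variable {X : Type*} [NormedAddCommGroup X] [NormedSpace ℝ X]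

/-- The vectors of a stage, as an operator on `ℓ∞({0, …, n - 1})`. -/
def Stage.v {lam K : ℝ} (s : Stage X lam K) : (↥(Finset.range s.n) → ℝ) →ₗ[ℝ] X :=
  s.u ∘ₗ LinearMap.funLeft ℝ ℝ fun i => ⟨i, Finset.mem_range.2 i.2⟩

lemma Stage.range_v {lam K : ℝ} (s : Stage X lam K) :
    LinearMap.range s.v = LinearMap.range s.u :=
  LinearMap.range_comp_of_range_eq_top _ (LinearMap.range_eq_top.2 fun w =>
    ⟨fun j => w ⟨j, Finset.mem_range.1 j.2⟩, rfl⟩)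

lemma Stage.norm_v_le {lam K : ℝ} (s : Stage X lam K) (hD : 0 ≤ stageConst lam K)
    (x : ↥(Finset.range s.n) → ℝ) : ‖s.v x‖ ≤ stageConst lam K * ‖x‖ :=
  (s.bound _).trans (mul_le_mul_of_nonneg_left
    ((pi_norm_le_iff_of_nonneg (norm_nonneg x)).2 fun _ => norm_le_pi_norm x _) hD)

lemma Stage.apply_v {lam K : ℝ} (s : Stage X lam K) (x : ↥(Finset.range s.n) → ℝ)
    (i : ↥(Finset.range s.n)) : s.f i (s.v x) = x i :=
  s.apply_u _ ⟨i, Finset.mem_range.1 i.2⟩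

/-- Every separable infinite-dimensional `ℒ∞`-space is isomorphic to a Bourgain-Delbaen space. -/
lemma exists_equiv_space [CompleteSpace X] [TopologicalSpace.SeparableSpace X] {lam : ℝ}
    (hlam : 1 ≤ lam) (hinf : ¬FiniteDimensional ℝ X) (hX : LocallyLinfty X lam) :
    ∃ S : BD.System ℕ, Nonempty (X ≃L[ℝ] ↥S.space) := by
  have hlam0 : 0 ≤ lam := by linarith
  obtain ⟨K, Y, hK, hY⟩ := exists_isLinftyDual hX hlam hinf
  have hD : 0 ≤ stageConst lam K := by
    have : 0 ≤ K := by linarith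
    unfold stageConst
    positivity
  choose next hn hf hu hx using fun s : Stage X lam K => s.exists_next hX hK hlam0 hinf
  let init : Stage X lam K :=
    { n := 0, Y := Y, f := Y, u := 0, isLinftyDual := hY
      near := fun k hk => absurd hk k.not_lt_zero
      bound := fun v => by simpa using mul_nonneg hD (norm_nonneg v)
      apply_u := fun _ i => i.elim0 }
  let st : ℕ → Stage X lam K := fun p =>
    Nat.rec init (fun p s => next s (TopologicalSpace.denseSeq X p)) p
  have hst : StrictMono fun p => (st p).n := strictMono_nat_of_lt_succ fun p => hn _ _
  have hfst : ∀ p q, p ≤ q → ∀ k < (st p).n, (st q).f k = (st p).f k := by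
    intro p q hpq k hk
    induction q, hpq using Nat.le_induction with
    | base => rfl
    | succ q hpq ih => exact (hf _ _ k (hk.trans_le (hst.monotone hpq))).trans ih
  have hlt : ∀ k, k < (st (k + 1)).n := fun k => hst.le_apply (x := k + 1)
  let g : ℕ → X →L[ℝ] ℝ := fun k => (st (k + 1)).f k
  have hg : ∀ p k, k < (st p).n → g k = (st p).f k := fun p k hk => by
    rcases le_total p (k + 1) with h | h
    · exact hfst _ _ h k hk
    · exact (hfst _ _ h k (hlt k)).symm
  have hrange : Monotone fun p => LinearMap.range (st p).u :=
    monotone_nat_of_le_succ fun p => hu _ _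
  refine nonempty_equiv_space (f := g) (C := 2) (n := fun p => (st (p + 1)).n)
    (u := fun p => (st (p + 1)).v) (fun k => (st (k + 1)).norm_f_le hK (hlt k))
    (fun p q h => hst (Nat.succ_lt_succ h)) (fun p => (Nat.zero_le p).trans_lt (hlt p))
    (fun p => (st (p + 1)).norm_v_le hD) (fun p v i => ?_) (fun p q h => ?_) ?_
  · rw [hg (p + 1) i (Finset.mem_range.1 i.2)]
    exact (st (p + 1)).apply_v v i
  · rw [Stage.range_v, Stage.range_v]
    exact hrange (Nat.succ_le_succ h.le)
  · refine (TopologicalSpace.denseRange_denseSeq X).mono ?_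
    rintro - ⟨p, rfl⟩
    refine Set.mem_iUnion.2 ⟨p, ?_⟩
    rw [Stage.range_v]
    exact hx _ _

end Main

end LinftyBD

/-- Every separable infinite dimensional `L_∞`-space is isomorphic, as a
Banach space, to a Bourgain–Delbaen space. -/
theorem statement15 {X : Type*} [NormedAddCommGroup X] [NormedSpace ℝ X] [CompleteSpace X]
    [TopologicalSpace.SeparableSpace X] (hinf : ¬FiniteDimensional ℝ X)
    (hX : IsLinftySpace X) :
    ∃ (Γ : Type) (S : BD.System Γ), Nonempty (X ≃L[ℝ] ↥S.space) := by
  obtain ⟨C, hC, hXC⟩ := hX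
  have : Nontrivial X := by
    by_contra h
    rw [not_nontrivial_iff_subsingleton] at h
    exact hinf inferInstance
  exact ⟨ℕ, LinftyBD.exists_equiv_space hC hinf (LinftyBD.locallyLinfty_of_isLinftyCSpace hXC)⟩
end
end
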